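/- arXiv:1908.03865 — 2 statements merged into one kernel-verified Lean document; each statement's English description precedes it below -/
import Mathlib

section
/- Let Δ0 = ABC, Δ1, Δ2 be triangles in ℝ³ with pairwise disjoint outlines such that ⟨Δ0⟩ ∩ ⟨Δ1⟩ ∩ ⟨Δ2⟩ ≠ ∅ and for each j ∈ {0,1,2} the set ∂Δj ∩ ⟨Δ_{(j+1) mod 3}⟩ consists of exactly two points. Let C' be a point not on the line AB such that (⟨A,C,C'⟩ ∪ ⟨B,C,C'⟩) ∩ (∂Δ1 ∪ ∂Δ2) = ∅, and let Δ0' = ABC'. Then ∂Δ2 ∩ ⟨Δ0'⟩ consists of exactly two points. -/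
open scoped Matrix

noncomputable section

/-- A point of 3-space. -/
abbrev Pt : Type := Fin 3 → ℝ

/-- A (non-degenerate) triangle in 3-space, given by three affinely independent vertices. -/
structure Tri where
  A : Pt
  B : Pt
  C : Pt
  indep : AffineIndependent ℝ ![A, B, C]

namespace Tri

/-- The set of vertices of a triangle. -/
def vertexSet (T : Tri) : Set Pt := {T.A, T.B, T.C}

/-- The outline `∂T` of a triangle: the union of the three closed edges. -/
def outline (T : Tri) : Set Pt :=
  segment ℝ T.A T.B ∪ segment ℝ T.B T.C ∪ segment ℝ T.C T.A

/-- The convex hull `⟨T⟩` of a triangle. -/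
def hull (T : Tri) : Set Pt := convexHull ℝ {T.A, T.B, T.C}

end Tri

/-- A family of triangles is a linking if the outlines are pairwise disjoint. -/
def IsLinking {ι : Type*} (T : ι → Tri) : Prop :=
  ∀ i j, i ≠ j → Disjoint (T i).outline (T j).outline

/-- An elementary move replaces one triangle `ABC` of the family by `ABC'`, where `C'` is a
point not on the line `AB` such that `(⟨A,C,C'⟩ ∪ ⟨B,C,C'⟩) ∩ ∂XYZ = ∅` for every other
triangle `XYZ` of the family. -/
def ElemMove {ι : Type*} (T T' : ι → Tri) : Prop :=
  ∃ (i : ι) (A B C C' : Pt),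
    (T i).vertexSet = {A, B, C} ∧
    (T' i).vertexSet = {A, B, C'} ∧
    C' ∉ affineSpan ℝ ({A, B} : Set Pt) ∧
    ∀ j, j ≠ i →
      (convexHull ℝ ({A, C, C'} : Set Pt) ∪ convexHull ℝ ({B, C, C'} : Set Pt))
          ∩ (T j).outline = ∅ ∧
      T' j = T j

/-- Two families of triangles are combinatorially isotopic if one can be obtained from the
other by a finite sequence of elementary moves. -/
def CombIsotopic {ι : Type*} (T T' : ι → Tri) : Prop :=
  Relation.ReflTransGen ElemMove T T'

/-- affine functional -/
def Aff (g : Pt → ℝ) : Prop := ∃ (l : Pt →ₗ[ℝ] ℝ) (k : ℝ), ∀ x, g x = l x + k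

/-- explicit convex hull of three points -/
def H3 (A B C x : Pt) : Prop :=
  ∃ a b c : ℝ, 0 ≤ a ∧ 0 ≤ b ∧ 0 ≤ c ∧ a + b + c = 1 ∧ x = a • A + b • B + c • C

/-- explicit segment -/
def H2 (A B x : Pt) : Prop :=
  ∃ a b : ℝ, 0 ≤ a ∧ 0 ≤ b ∧ a + b = 1 ∧ x = a • A + b • B

theorem Aff.c3 {g : Pt → ℝ} (hg : Aff g) {a b c : ℝ} (h : a + b + c = 1) (A B C : Pt) :
    g (a • A + b • B + c • C) = a * g A + b * g B + c * g C := by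
  obtain ⟨l, k, hl⟩ := hg
  simp only [hl, map_add, map_smul, smul_eq_mul]
  linear_combination -k * h

theorem Aff.c2 {g : Pt → ℝ} (hg : Aff g) {a b : ℝ} (h : a + b = 1) (A B : Pt) :
    g (a • A + b • B) = a * g A + b * g B := by
  obtain ⟨l, k, hl⟩ := hg
  simp only [hl, map_add, map_smul, smul_eq_mul]
  linear_combination -k * h

theorem Aff.neg {g : Pt → ℝ} (hg : Aff g) : Aff (fun x => - g x) := by
  obtain ⟨l, k, hl⟩ := hg
  exact ⟨-l, -k, fun x => by simp [hl]; ring⟩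

theorem mem_hull3 (A B C x : Pt) : x ∈ convexHull ℝ ({A, B, C} : Set Pt) ↔ H3 A B C x := by
  rw [convexHull_insert (by simp), convexHull_pair]
  simp only [convexJoin_singleton_left, Set.mem_iUnion, segment, H3, Set.mem_ofPred_eq]
  constructor
  · rintro ⟨y, ⟨p, q, hp, hq, hpq, rfl⟩, a, b, ha, hb, hab, rfl⟩
    refine ⟨a, b * p, b * q, ha, by positivity, by positivity, ?_, ?_⟩
    · linear_combination hab + b * hpq
    · module
  · rintro ⟨a, b, c, ha, hb, hc, h, rfl⟩
    by_cases hbc : b + c = 0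
    · have hb0 : b = 0 := by linarith
      have hc0 : c = 0 := by linarith
      refine ⟨B, ⟨1, 0, by norm_num, by norm_num, by norm_num, by simp⟩, 1, 0, by norm_num, by norm_num, by norm_num, ?_⟩
      have : a = 1 := by linarith
      simp [hb0, hc0, this]
    · have : 0 < b + c := lt_of_le_of_ne (by linarith) (Ne.symm hbc)
      refine ⟨(b / (b + c)) • B + (c / (b + c)) • C,
        ⟨b / (b + c), c / (b + c), by positivity, by positivity, by field_simp, rfl⟩, a, b + c, ha, by linarith, by linarith, ?_⟩
      rw [smul_add, smul_smul, smul_smul, mul_div_cancel₀ _ hbc, mul_div_cancel₀ _ hbc, add_assoc]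

theorem mem_seg (A B x : Pt) : x ∈ segment ℝ A B ↔ H2 A B x := by
  simp only [segment, H2, Set.mem_ofPred_eq]
  constructor
  · rintro ⟨a, b, ha, hb, hab, rfl⟩; exact ⟨a, b, ha, hb, hab, rfl⟩
  · rintro ⟨a, b, ha, hb, hab, rfl⟩; exact ⟨a, b, ha, hb, hab, rfl⟩

theorem H2.symm {A B x : Pt} (h : H2 A B x) : H2 B A x := by
  obtain ⟨a, b, ha, hb, hab, rfl⟩ := h
  exact ⟨b, a, hb, ha, by linarith, add_comm _ _⟩

theorem H3.conv {A B C x y z : Pt} (hx : H3 A B C x) (hy : H3 A B C y) (hz : H2 x y z) :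
    H3 A B C z := by
  rw [← mem_hull3] at *
  rw [← mem_seg] at hz
  exact (convex_convexHull ℝ _).segment_subset hx hy hz

/-- coordinates adapted to a triangle -/
structure Coord (T : Tri) (a b c g : Pt → ℝ) : Prop where
  Aa : Aff a
  Ab : Aff b
  Ac : Aff c
  Ag : Aff g
  sum : ∀ x, a x + b x + c x = 1
  aA : a T.A = 1
  aB : a T.B = 0
  aC : a T.C = 0
  bA : b T.A = 0
  bB : b T.B = 1
  bC : b T.C = 0
  cA : c T.A = 0
  cB : c T.B = 0
  cC : c T.C = 1
  gA : g T.A = 0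
  gB : g T.B = 0
  gC : g T.C = 0
  rep : ∃ N : Pt, ∀ x, x = a x • T.A + b x • T.B + c x • T.C + g x • N

theorem exists_coord (T : Tri) : ∃ a b c g, Coord T a b c g := by
  have hind := T.indep
  rw [affineIndependent_iff_linearIndependent_vsub ℝ _ (0 : Fin 3)] at hind
  have h2 : LinearIndependent ℝ ![T.B - T.A, T.C - T.A] := by
    have := hind.comp (fun i : Fin 2 => (⟨i.succ, by simp⟩ : {x : Fin 3 // x ≠ 0}))
      (by intro i j h; simpa using h)
    have he : ![T.B - T.A, T.C - T.A] =
        ((fun i : {x : Fin 3 // x ≠ 0} => ![T.A, T.B, T.C] ↑i -ᵥ ![T.A, T.B, T.C] 0) ∘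
          fun i : Fin 2 => (⟨i.succ, by simp⟩ : {x : Fin 3 // x ≠ 0})) := by
      ext i j
      fin_cases i <;> simp
    rw [he]
    exact this
  set u := T.B - T.A with hu
  set v := T.C - T.A with hv
  obtain ⟨N, hN⟩ : ∃ N : Pt, N ∉ Submodule.span ℝ (Set.range ![u, v]) := by
    by_contra! hcon
    have h1 := finrank_span_eq_card h2
    have : Submodule.span ℝ (Set.range ![u, v]) = ⊤ := by
      rw [eq_top_iff]; intro x _; exact hcon x
    rw [this, finrank_top] at h1
    simp at h1
  have h3 : LinearIndependent ℝ ![N, u, v] := by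
    exact linearIndependent_finCons.2 ⟨h2, hN⟩
  let bs := basisOfLinearIndependentOfCardEqFinrank h3 (by simp)
  have hbs : ∀ i, bs i = ![N, u, v] i := fun i => by simp [bs]
  have e0 : bs 0 = N := by simp [hbs]
  have e1 : bs 1 = u := by simp [hbs]
  have e2 : bs 2 = v := by simp [hbs]
  have key : ∀ i x, bs.coord i (x - T.A) = bs.coord i x + -(bs.coord i T.A) := by
    intro i x; rw [map_sub]; ring
  refine ⟨fun x => 1 - bs.coord 1 (x - T.A) - bs.coord 2 (x - T.A),
    fun x => bs.coord 1 (x - T.A), fun x => bs.coord 2 (x - T.A),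
    fun x => bs.coord 0 (x - T.A), ?_⟩
  have hB : ∀ i, bs.coord i (T.B - T.A) = if (1 : Fin 3) = i then 1 else 0 := by
    intro i; rw [← hu, ← e1]; simp [Finsupp.single_apply]
  have hC : ∀ i, bs.coord i (T.C - T.A) = if (2 : Fin 3) = i then 1 else 0 := by
    intro i; rw [← hv, ← e2]; simp [Finsupp.single_apply]
  have hA : ∀ i, bs.coord i (T.A - T.A) = 0 := by intro i; rw [sub_self, map_zero]
  constructor
  · exact ⟨-bs.coord 1 - bs.coord 2, 1 + bs.coord 1 T.A + bs.coord 2 T.A, fun x => by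
      simp only [key, LinearMap.sub_apply, LinearMap.neg_apply]; ring⟩
  · exact ⟨_, _, key 1⟩
  · exact ⟨_, _, key 2⟩
  · exact ⟨_, _, key 0⟩
  · intro x; ring
  · simp only [hA]; norm_num
  · simp only [hB]; norm_num <;> decide
  · simp only [hC]; norm_num <;> decide
  · simp only [hA]
  · simp only [hB]; norm_num <;> decide
  · simp only [hC]; norm_num <;> decide
  · simp only [hA]
  · simp only [hB]; norm_num <;> decide
  · simp only [hC]; norm_num <;> decide
  · simp only [hA]
  · simp only [hB]; norm_num <;> decide
  · simp only [hC]; norm_num <;> decide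
  · refine ⟨N, fun x => ?_⟩
    have := bs.sum_repr (x - T.A)
    rw [Fin.sum_univ_three, e0, e1, e2] at this
    simp only [Module.Basis.coord_apply]
    have hx : x = T.A + (x - T.A) := by abel
    conv_lhs => rw [hx, ← this]
    rw [hu, hv]
    module

section
variable {T : Tri} {a b c g : Pt → ℝ}

theorem Coord.rep0 (h : Coord T a b c g) {x : Pt} (hx : g x = 0) :
    x = a x • T.A + b x • T.B + c x • T.C := by
  obtain ⟨N, hN⟩ := h.rep
  have := hN x
  rwa [hx, zero_smul, add_zero] at this

theorem Coord.vals (h : Coord T a b c g) {p q r : ℝ} (hs : p + q + r = 1) :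
    a (p • T.A + q • T.B + r • T.C) = p ∧ b (p • T.A + q • T.B + r • T.C) = q ∧
    c (p • T.A + q • T.B + r • T.C) = r ∧ g (p • T.A + q • T.B + r • T.C) = 0 := by
  rw [h.Aa.c3 hs, h.Ab.c3 hs, h.Ac.c3 hs, h.Ag.c3 hs]
  simp [h.aA, h.aB, h.aC, h.bA, h.bB, h.bC, h.cA, h.cB, h.cC, h.gA, h.gB, h.gC]

theorem Coord.hull_iff (h : Coord T a b c g) (x : Pt) :
    x ∈ T.hull ↔ g x = 0 ∧ 0 ≤ a x ∧ 0 ≤ b x ∧ 0 ≤ c x := by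
  rw [Tri.hull, mem_hull3]
  constructor
  · rintro ⟨p, q, r, hp, hq, hr, hs, rfl⟩
    obtain ⟨h1, h2, h3, h4⟩ := h.vals hs
    rw [h1, h2, h3, h4]; exact ⟨rfl, hp, hq, hr⟩
  · rintro ⟨h0, h1, h2, h3⟩
    exact ⟨_, _, _, h1, h2, h3, h.sum x, h.rep0 h0⟩

theorem Coord.out_iff (h : Coord T a b c g) (x : Pt) :
    x ∈ T.outline ↔ x ∈ T.hull ∧ (a x = 0 ∨ b x = 0 ∨ c x = 0) := by
  rw [Tri.outline, Set.mem_union, Set.mem_union, mem_seg, mem_seg, mem_seg]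
  constructor
  · rintro ((⟨p, q, hp, hq, hs, hx⟩ | ⟨p, q, hp, hq, hs, hx⟩) | ⟨p, q, hp, hq, hs, hx⟩)
    · have hx' : x = p • T.A + q • T.B + (0:ℝ) • T.C := by rw [hx]; module
      obtain ⟨h1, h2, h3, h4⟩ := h.vals (p := p) (q := q) (r := 0) (by linarith)
      rw [h.hull_iff, hx', h1, h2, h3, h4]; simp [hp, hq]
    · have hx' : x = (0:ℝ) • T.A + p • T.B + q • T.C := by rw [hx]; module
      obtain ⟨h1, h2, h3, h4⟩ := h.vals (p := 0) (q := p) (r := q) (by linarith)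
      rw [h.hull_iff, hx', h1, h2, h3, h4]; simp [hp, hq]
    · have hx' : x = q • T.A + (0:ℝ) • T.B + p • T.C := by rw [hx]; module
      obtain ⟨h1, h2, h3, h4⟩ := h.vals (p := q) (q := 0) (r := p) (by linarith)
      rw [h.hull_iff, hx', h1, h2, h3, h4]; simp [hp, hq]
  · rintro ⟨hx, h0⟩
    obtain ⟨hg, ha, hb, hc⟩ := (h.hull_iff x).1 hx
    have hr := h.rep0 hg
    have hs := h.sum x
    rcases h0 with h0 | h0 | h0
    · left; right
      rw [h0, zero_smul, zero_add] at hr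
      exact ⟨_, _, hb, hc, by linarith, hr⟩
    · right
      rw [h0, zero_smul, add_zero] at hr
      exact H2.symm ⟨_, _, ha, hc, by linarith, hr⟩
    · left; left
      rw [h0, zero_smul, add_zero] at hr
      exact ⟨_, _, ha, hb, by linarith, hr⟩

/-- relative interior -/
def Tri.int (T : Tri) : Set Pt := T.hull \ T.outline

theorem Coord.int_iff (h : Coord T a b c g) (x : Pt) :
    x ∈ T.int ↔ g x = 0 ∧ 0 < a x ∧ 0 < b x ∧ 0 < c x := by
  rw [Tri.int, Set.mem_sdiff, h.out_iff, h.hull_iff]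
  constructor
  · rintro ⟨⟨h0, h1, h2, h3⟩, h4⟩
    have : ¬ (a x = 0 ∨ b x = 0 ∨ c x = 0) := fun h5 => h4 ⟨⟨h0, h1, h2, h3⟩, h5⟩
    push Not at this
    exact ⟨h0, lt_of_le_of_ne h1 this.1.symm, lt_of_le_of_ne h2 this.2.1.symm,
      lt_of_le_of_ne h3 this.2.2.symm⟩
  · rintro ⟨h0, h1, h2, h3⟩
    refine ⟨⟨h0, h1.le, h2.le, h3.le⟩, ?_⟩
    rintro ⟨-, h | h | h⟩ <;> linarith
end

theorem pos_comb {s t u v : ℝ} (hs : 0 ≤ s) (ht : 0 ≤ t) (hst : s + t = 1) (hu : 0 < u)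
    (hv : 0 < v) : 0 < s * u + t * v := by
  rcases hs.lt_or_eq with h | h
  · have := mul_pos h hu; have := mul_nonneg ht hv.le; linarith
  · have : t = 1 := by linarith
    rw [← h, this]; linarith

theorem int_conv {T : Tri} {x y z : Pt} (hx : x ∈ T.int) (hy : y ∈ T.int) (hz : H2 x y z) :
    z ∈ T.int := by
  obtain ⟨a, b, c, g, h⟩ := exists_coord T
  rw [h.int_iff] at *
  obtain ⟨s, t, hs, ht, hst, rfl⟩ := hz
  obtain ⟨x0, x1, x2, x3⟩ := hx
  obtain ⟨y0, y1, y2, y3⟩ := hy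
  rw [h.Ag.c2 hst, h.Aa.c2 hst, h.Ab.c2 hst, h.Ac.c2 hst, x0, y0]
  exact ⟨by ring, pos_comb hs ht hst x1 y1, pos_comb hs ht hst x2 y2, pos_comb hs ht hst x3 y3⟩

/-- exit lemma -/
theorem exit_lemma {a b c p q r t₀ : ℝ} (ha : 0 ≤ a) (hb : 0 ≤ b) (hc : 0 ≤ c) (ht : 0 ≤ t₀)
    (hneg : a + t₀ * p < 0 ∨ b + t₀ * q < 0 ∨ c + t₀ * r < 0) :
    ∃ t, 0 ≤ t ∧ t ≤ t₀ ∧ 0 ≤ a + t * p ∧ 0 ≤ b + t * q ∧ 0 ≤ c + t * r ∧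
      (a + t * p = 0 ∨ b + t * q = 0 ∨ c + t * r = 0) := by
  let f : ℝ → ℝ := fun t => min (a + t * p) (min (b + t * q) (c + t * r))
  have hf : ContinuousOn f (Set.Icc 0 t₀) := by fun_prop
  have h0 : 0 ≤ f 0 := by simp [f, ha, hb, hc]
  have h1 : f t₀ ≤ 0 := by
    simp only [f, min_le_iff]
    rcases hneg with h | h | h
    · left; exact h.le
    · right; left; exact h.le
    · right; right; exact h.le
  obtain ⟨t, ⟨ht0, ht1⟩, hft⟩ := intermediate_value_Icc' ht hf ⟨h1, h0⟩
  have hft' : min (a + t * p) (min (b + t * q) (c + t * r)) = 0 := hft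
  have hle := hft'.ge
  simp only [le_min_iff] at hle
  refine ⟨t, ht0, ht1, hle.1, hle.2.1, hle.2.2, ?_⟩
  rcases min_choice (a + t * p) (min (b + t * q) (c + t * r)) with h | h
  · left; rw [← h]; exact hft'
  · right
    rw [h] at hft'
    rcases min_choice (b + t * q) (c + t * r) with h | h
    · left; rw [← h]; exact hft'
    · right; rw [← h]; exact hft'

theorem cross {T : Tri} {a b c g : Pt → ℝ} (h : Coord T a b c g) {x y : Pt}
    (hx : x ∈ T.hull) (hy0 : g y = 0) (hy : y ∉ T.hull) : ∃ z, H2 x y z ∧ z ∈ T.outline := by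
  obtain ⟨x0, x1, x2, x3⟩ := (h.hull_iff x).1 hx
  have hneg : a y < 0 ∨ b y < 0 ∨ c y < 0 := by
    by_contra! hcon
    exact hy ((h.hull_iff y).2 ⟨hy0, hcon⟩)
  obtain ⟨t, ht0, ht1, e1, e2, e3, e4⟩ := exit_lemma (t₀ := 1) (p := a y - a x) (q := b y - b x)
    (r := c y - c x) x1 x2 x3 zero_le_one (by
      rcases hneg with h | h | h
      · left; linarith
      · right; left; linarith
      · right; right; linarith)
  have hs : (1 - t) + t = 1 := by ring
  refine ⟨(1 - t) • x + t • y, ⟨1 - t, t, by linarith, ht0, hs, rfl⟩, ?_⟩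
  rw [h.out_iff, h.hull_iff, h.Ag.c2 hs, h.Aa.c2 hs, h.Ab.c2 hs, h.Ac.c2 hs, x0, hy0]
  have i1 : (1 - t) * a x + t * a y = a x + t * (a y - a x) := by ring
  have i2 : (1 - t) * b x + t * b y = b x + t * (b y - b x) := by ring
  have i3 : (1 - t) * c x + t * c y = c x + t * (c y - c x) := by ring
  rw [i1, i2, i3]
  exact ⟨⟨by ring, e1, e2, e3⟩, e4⟩

theorem seg_zero {g : Pt → ℝ} (hg : Aff g) {A C : Pt} (h : g A * g C ≤ 0) :
    ∃ y, H2 A C y ∧ g y = 0 := by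
  by_cases h0 : g A = 0
  · exact ⟨A, ⟨1, 0, by norm_num, le_rfl, by norm_num, by simp⟩, h0⟩
  have hne : g A - g C ≠ 0 := by
    intro h1
    have : g C = g A := by linarith
    rw [this] at h
    exact h0 (by nlinarith [mul_self_nonneg (g A), mul_self_eq_zero.1 (le_antisymm h (mul_self_nonneg _))])
  have hs : (-(g C) / (g A - g C)) + (g A / (g A - g C)) = 1 := by field_simp; ring
  refine ⟨(-(g C) / (g A - g C)) • A + (g A / (g A - g C)) • C, ⟨_, _, ?_, ?_, hs, rfl⟩, ?_⟩
  · rw [div_nonneg_iff]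
    rcases lt_or_gt_of_ne h0 with h1 | h1
    · right; constructor <;> nlinarith
    · left; constructor <;> nlinarith
  · rw [div_nonneg_iff]
    rcases lt_or_gt_of_ne h0 with h1 | h1
    · right; constructor <;> nlinarith
    · left; constructor <;> nlinarith
  · rw [hg.c2 hs]; field_simp; ring

theorem same_sign {g : Pt → ℝ} (hg : Aff g) {A B C x : Pt} (h1 : 0 < g A * g C)
    (h2 : 0 < g B * g C) (hx : H3 A B C x) : g x ≠ 0 := by
  obtain ⟨a, b, c, ha, hb, hc, hs, rfl⟩ := hx
  rw [hg.c3 hs]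
  intro h
  have hC : g C ≠ 0 := by rintro h; rw [h] at h1; simp at h1
  have h3 : 0 < g C * g C := mul_self_pos.2 hC
  have h4 : a * (g A * g C) + b * (g B * g C) + c * (g C * g C) = 0 := by
    linear_combination g C * h
  have e1 := mul_nonneg ha h1.le
  have e2 := mul_nonneg hb h2.le
  have e3 := mul_nonneg hc h3.le
  have a0 : a = 0 := by
    have : a * (g A * g C) = 0 := by linarith
    simpa [h1.ne'] using (mul_eq_zero.1 this).resolve_right h1.ne'
  have b0 : b = 0 := by
    have : b * (g B * g C) = 0 := by linarith
    exact (mul_eq_zero.1 this).resolve_right h2.ne'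
  have c0 : c = 0 := by
    have : c * (g C * g C) = 0 := by linarith
    exact (mul_eq_zero.1 this).resolve_right h3.ne'
  linarith

theorem H3.left {A B C x : Pt} (h : H2 A B x) : H3 A B C x := by
  obtain ⟨a, b, ha, hb, hs, rfl⟩ := h
  exact ⟨a, b, 0, ha, hb, le_rfl, by linarith, by simp⟩

theorem H3.right {A B C x : Pt} (h : H2 B C x) : H3 A B C x := by
  obtain ⟨a, b, ha, hb, hs, rfl⟩ := h
  exact ⟨0, a, b, le_rfl, ha, hb, by linarith, by simp⟩

theorem H3.outer {A B C x : Pt} (h : H2 A C x) : H3 A B C x := by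
  obtain ⟨a, b, ha, hb, hs, rfl⟩ := h
  exact ⟨a, 0, b, ha, le_rfl, hb, by linarith, by simp⟩

theorem H3.rot {A B C x : Pt} (h : H3 A B C x) : H3 B C A x := by
  obtain ⟨a, b, c, ha, hb, hc, hs, rfl⟩ := h
  exact ⟨b, c, a, hb, hc, ha, by linarith, by abel⟩

theorem H3.swap {A B C x : Pt} (h : H3 A B C x) : H3 B A C x := by
  obtain ⟨a, b, c, ha, hb, hc, hs, rfl⟩ := h
  exact ⟨b, a, c, hb, ha, hc, by linarith, by abel⟩

/-- connectivity lemma -/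
theorem conn {g : Pt → ℝ} (hg : Aff g) {A B C D : Pt} (H : Pt → Prop)
    (hO : ∃ x, H3 A B C x ∧ g x = 0)
    (hA : ∀ y, H2 A C y → g y = 0 → H y) (hB : ∀ y, H2 B C y → g y = 0 → H y)
    (tA : ∀ x y, H3 A C D x → H3 A C D y → g x = 0 → g y = 0 → H y → H x)
    (tB : ∀ x y, H3 B C D x → H3 B C D y → g x = 0 → g y = 0 → H y → H x) :
    ∀ x, H3 A C D x → g x = 0 → H x := by
  intro x hx hx0
  by_cases h1 : g A * g C ≤ 0
  · obtain ⟨y, hy, hy0⟩ := seg_zero hg h1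
    exact tA x y hx (H3.left hy) hx0 hy0 (hA y hy hy0)
  push Not at h1
  have h2 : g C * g D ≤ 0 := by
    by_contra! h2
    exact same_sign hg (A := A) (B := D) (C := C) h1 (by linarith) hx.swap.rot hx0
  have h3 : g B * g C ≤ 0 := by
    by_contra! h3
    obtain ⟨o, ho, ho0⟩ := hO
    exact same_sign hg h1 h3 ho ho0
  obtain ⟨z, hz, hz0⟩ := seg_zero hg h2
  obtain ⟨y, hy, hy0⟩ := seg_zero hg h3
  exact tA x z hx (H3.right hz) hx0 hz0
    (tB z y (H3.right hz) (H3.left hy) hz0 hy0 (hB y hy hy0))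

theorem edge_of_zero {A B C : Pt} {a b c : ℝ} (ha : 0 ≤ a) (hb : 0 ≤ b) (hc : 0 ≤ c)
    (hs : a + b + c = 1) (h : a = 0 ∨ b = 0 ∨ c = 0) :
    H2 A B (a • A + b • B + c • C) ∨ H2 B C (a • A + b • B + c • C) ∨
      H2 A C (a • A + b • B + c • C) := by
  rcases h with rfl | rfl | rfl
  · right; left; exact ⟨b, c, hb, hc, by linarith, by simp⟩
  · right; right; exact ⟨a, c, ha, hc, by linarith, by simp⟩
  · left; exact ⟨a, b, ha, hb, by linarith, by simp⟩

theorem exists_neg {a b c p q r : ℝ} (hs : p + q + r = 0) (hn : ¬ (p = 0 ∧ q = 0 ∧ r = 0)) :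
    ∃ t₀ : ℝ, 0 ≤ t₀ ∧ (a + t₀ * p < 0 ∨ b + t₀ * q < 0 ∨ c + t₀ * r < 0) := by
  have aux : ∀ a p : ℝ, p < 0 → ∃ t₀ : ℝ, 0 ≤ t₀ ∧ a + t₀ * p < 0 := by
    intro a p hp
    refine ⟨(|a| + 1) / (-p), by have : 0 < -p := by linarith
                                 positivity, ?_⟩
    have : (|a| + 1) / (-p) * p = -(|a| + 1) := by
      have := hp.ne
      field_simp
    rw [this]; linarith [le_abs_self a]
  by_cases hp : p < 0
  · obtain ⟨t, h1, h2⟩ := aux a p hp; exact ⟨t, h1, Or.inl h2⟩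
  by_cases hq : q < 0
  · obtain ⟨t, h1, h2⟩ := aux b q hq; exact ⟨t, h1, Or.inr (Or.inl h2)⟩
  by_cases hr : r < 0
  · obtain ⟨t, h1, h2⟩ := aux c r hr; exact ⟨t, h1, Or.inr (Or.inr h2)⟩
  push Not at hp hq hr
  exact absurd ⟨by linarith, by linarith, by linarith⟩ hn

/-- 2D lemma -/
theorem two_dim {g : Pt → ℝ} (hg : Aff g) {A B C : Pt} (S : Pt → Prop)
    (hS : ∀ x y z, S x → S y → H2 x y z → S z)
    (h1 : ∀ y, H2 A B y → g y = 0 → S y) (h2 : ∀ y, H2 B C y → g y = 0 → S y)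
    (h3 : ∀ y, H2 A C y → g y = 0 → S y) : ∀ x, H3 A B C x → g x = 0 → S x := by
  intro x hx hx0
  -- general half ray
  have ray : ∀ a b c p q r : ℝ, 0 ≤ a → 0 ≤ b → 0 ≤ c → a + b + c = 1 →
      a * g A + b * g B + c * g C = 0 → p + q + r = 0 → p * g A + q * g B + r * g C = 0 →
      ¬ (p = 0 ∧ q = 0 ∧ r = 0) → ∃ t : ℝ, 0 ≤ t ∧
        S ((a + t * p) • A + (b + t * q) • B + (c + t * r) • C) := by
    intro a b c p q r ha hb hc hs h0 hs' h0' hn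
    obtain ⟨t₀, ht, hneg⟩ := exists_neg (a := a) (b := b) (c := c) hs' hn
    obtain ⟨t, ht0, -, e1, e2, e3, e4⟩ := exit_lemma ha hb hc ht hneg
    have hs2 : (a + t * p) + (b + t * q) + (c + t * r) = 1 := by linear_combination hs + t * hs'
    have hz : g ((a + t * p) • A + (b + t * q) • B + (c + t * r) • C) = 0 := by
      rw [hg.c3 hs2]; linear_combination h0 + t * h0'
    refine ⟨t, ht0, ?_⟩
    rcases edge_of_zero (A := A) (B := B) (C := C) e1 e2 e3 hs2 e4 with h | h | h
    · exact h1 _ h hz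
    · exact h2 _ h hz
    · exact h3 _ h hz
  obtain ⟨a, b, c, ha, hb, hc, hs, rfl⟩ := hx
  rw [hg.c3 hs] at hx0
  have hex : ∃ p q r : ℝ, p + q + r = 0 ∧ p * g A + q * g B + r * g C = 0 ∧
      ¬ (p = 0 ∧ q = 0 ∧ r = 0) := by
    by_cases he : g A = g B ∧ g B = g C
    · refine ⟨1, -1, 0, by norm_num, by rw [he.1]; ring, by norm_num⟩
    · refine ⟨g B - g C, g C - g A, g A - g B, by ring, by ring, ?_⟩
      rintro ⟨e1, e2, e3⟩
      exact he ⟨by linarith, by linarith⟩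
  obtain ⟨p, q, r, k1, k2, k3⟩ := hex
  obtain ⟨t, ht, hSt⟩ := ray a b c p q r ha hb hc hs hx0 k1 k2 k3
  obtain ⟨s, hs0, hSs⟩ := ray a b c (-p) (-q) (-r) ha hb hc hs hx0 (by linarith) (by linarith)
    (by simpa [neg_eq_zero] using k3)
  by_cases hst : s + t = 0
  · have : t = 0 := by linarith
    rw [this] at hSt
    simpa using hSt
  · have hpos : 0 < s + t := lt_of_le_of_ne (by linarith) (Ne.symm hst)
    refine hS _ _ _ hSt hSs ⟨s / (s + t), t / (s + t), by positivity, by positivity,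
      by field_simp, ?_⟩
    match_scalars <;> field_simp <;> ring

theorem uniq {g : Pt → ℝ} (hg : Aff g) {A B P Q : Pt} (hP : H2 A B P) (hQ : H2 A B Q)
    (hP0 : g P = 0) (hQ0 : g Q = 0) (hn : ¬ (g A = 0 ∧ g B = 0)) : P = Q := by
  obtain ⟨s, t, hs, ht, hst, rfl⟩ := hP
  obtain ⟨u, v, hu, hv, huv, rfl⟩ := hQ
  rw [hg.c2 hst] at hP0
  rw [hg.c2 huv] at hQ0
  have e : (s - u) * (g A - g B) = 0 := by
    linear_combination hP0 - hQ0 - g B * (hst - huv)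
  rcases mul_eq_zero.1 e with h | h
  · have h1 : s = u := by linarith
    have h2 : t = v := by linarith
    rw [h1, h2]
  · exfalso; apply hn
    have : g B = 0 := by linear_combination hP0 - s * h - g B * hst
    exact ⟨by linarith, this⟩

theorem sect_core {g : Pt → ℝ} (hg : Aff g) {A B C P Q : Pt} (hP : H2 A B P) (hQ : H2 B C Q)
    (hne : P ≠ Q) (hP0 : g P = 0) (hQ0 : g Q = 0) (n1 : ¬ (g A = 0 ∧ g B = 0))
    (n2 : ¬ (g B = 0 ∧ g C = 0)) : ∀ x, H3 A B C x → g x = 0 → H2 P Q x := by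
  have hB : g B ≠ 0 := by
    intro hB
    have e1 : P = B := uniq hg hP ⟨0, 1, le_rfl, by norm_num, by norm_num, by simp⟩ hP0 hB n1
    have e2 : Q = B := uniq hg hQ ⟨1, 0, by norm_num, le_rfl, by norm_num, by simp⟩ hQ0 hB n2
    exact hne (e1.trans e2.symm)
  obtain ⟨s, t, hs, ht, hst, rfl⟩ := hP
  obtain ⟨u, v, hu, hv, huv, rfl⟩ := hQ
  rw [hg.c2 hst] at hP0
  rw [hg.c2 huv] at hQ0
  have hs0 : s ≠ 0 := by
    rintro rfl
    have : t = 1 := by linarith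
    rw [this] at hP0; exact hB (by linarith)
  have hv0 : v ≠ 0 := by
    rintro rfl
    have : u = 1 := by linarith
    rw [this] at hQ0; exact hB (by linarith)
  rintro x ⟨a, b, c, ha, hb, hc, habc, rfl⟩ hx0
  rw [hg.c3 habc] at hx0
  have e1 : a / s * s = a := by field_simp
  have e2 : c / v * v = c := by field_simp
  have hb' : a / s * t + c / v * u = b := by
    apply mul_right_cancel₀ hB
    linear_combination (a / s) * hP0 + (c / v) * hQ0 - hx0 - g A * e1 - g C * e2
  refine ⟨a / s, c / v, by positivity, by positivity, ?_, ?_⟩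
  · linear_combination habc + hb' + e1 + e2 - (a / s) * hst - (c / v) * huv
  · rw [smul_add, smul_add, smul_smul, smul_smul, smul_smul, smul_smul, e1, e2]
    rw [← hb']; module

theorem edge_nd {T : Tri} {a b c g : Pt → ℝ} (h : Coord T a b c g) {V W P Q : Pt}
    (hP : P ∈ T.int) (hPe : H2 V W P) (hVW : V ≠ W) (hV : g V = 0) (hW : g W = 0)
    (hall : ∀ x, H2 V W x → x ∈ T.hull → x = P ∨ x = Q) : False := by
  obtain ⟨V', hV'P, hV'0, hsub⟩ : ∃ V', V' ≠ P ∧ g V' = 0 ∧ ∀ x, H2 P V' x → H2 V W x := by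
    have hl : ∀ x y, H2 V W x → H2 V W y → ∀ z, H2 x y z → H2 V W z := by
      intro x y hx hy z hz
      rw [← mem_seg] at *
      exact (convex_segment V W).segment_subset hx hy hz
    by_cases hVP : V = P
    · exact ⟨W, by rw [← hVP]; exact hVW.symm, hW, hl _ _ hPe
        ⟨0, 1, le_rfl, by norm_num, by norm_num, by simp⟩⟩
    · exact ⟨V, hVP, hV, hl _ _ hPe ⟨1, 0, by norm_num, le_rfl, by norm_num, by simp⟩⟩
  obtain ⟨p0, p1, p2, p3⟩ := (h.int_iff P).1 hP
  have ev : ∀ u k : ℝ, 0 < u → ∀ᶠ t in nhdsWithin (0:ℝ) (Set.Ioi 0), 0 ≤ (1 - t) * u + t * k := by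
    intro u k hu
    have hc : Filter.Tendsto (fun t : ℝ => (1 - t) * u + t * k) (nhds 0) (nhds ((1 - 0) * u + 0 * k)) := by
      apply Continuous.tendsto; fun_prop
    have : ∀ᶠ t in nhds (0:ℝ), 0 < (1 - t) * u + t * k :=
      hc.eventually (lt_mem_nhds (by simpa using hu))
    filter_upwards [nhdsWithin_le_nhds this] with t ht using ht.le
  have e1 : ∀ᶠ t in nhdsWithin (0:ℝ) (Set.Ioi 0), t < 1 :=
    nhdsWithin_le_nhds (gt_mem_nhds zero_lt_one)
  have e2 : ∀ᶠ t in nhdsWithin (0:ℝ) (Set.Ioi 0), t ∈ Set.Ioi (0:ℝ) := self_mem_nhdsWithin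
  obtain ⟨t, ht1, ht0, k1, k2, k3⟩ := (e1.and (e2.and ((ev _ (a V') p1).and
    ((ev _ (b V') p2).and (ev _ (c V') p3))))).exists
  have ht0 : 0 < t := ht0
  have mem : ∀ s, 0 < s → s ≤ t → (1 - s) • P + s • V' = Q := by
    intro s hs hst
    have hs1 : (1 - s) + s = 1 := by ring
    have hsub' := hsub ((1 - s) • P + s • V') ⟨1 - s, s, by linarith, hs.le, hs1, rfl⟩
    have lin : ∀ u k : ℝ, 0 < u → 0 ≤ (1 - t) * u + t * k → 0 ≤ (1 - s) * u + s * k := by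
      intro u k hu hk
      have : 0 ≤ t * ((1 - s) * u + s * k) := by
        nlinarith [mul_nonneg hs.le hk, mul_nonneg (sub_nonneg.2 hst) hu.le]
      exact nonneg_of_mul_nonneg_right this ht0
    have hh : (1 - s) • P + s • V' ∈ T.hull := by
      rw [h.hull_iff, h.Ag.c2 hs1, h.Aa.c2 hs1, h.Ab.c2 hs1, h.Ac.c2 hs1, p0, hV'0]
      exact ⟨by ring, lin _ _ p1 k1, lin _ _ p2 k2, lin _ _ p3 k3⟩
    rcases hall _ hsub' hh with h1 | h1
    · exfalso; apply hV'P
      have : s • (V' - P) = 0 := by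
        have h2 : s • (V' - P) = ((1 - s) • P + s • V') - P := by module
        rw [h2, h1, sub_self]
      rcases smul_eq_zero.1 this with h3 | h3
      · linarith
      · exact sub_eq_zero.1 h3
    · exact h1
  have m1 := mem t ht0 le_rfl
  have m2 := mem (t / 2) (by linarith) (by linarith)
  apply hV'P
  have : (t / 2) • (V' - P) = 0 := by
    have h2 : (t / 2) • (V' - P) = ((1 - t) • P + t • V') - ((1 - t / 2) • P + (t / 2) • V') := by
      module
    rw [h2, m1, m2, sub_self]
  rcases smul_eq_zero.1 this with h3 | h3
  · linarith
  · exact sub_eq_zero.1 h3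

theorem Tri.ne (T : Tri) : T.A ≠ T.B ∧ T.B ≠ T.C ∧ T.C ≠ T.A := by
  obtain ⟨a, b, c, g, h⟩ := exists_coord T
  refine ⟨fun e => ?_, fun e => ?_, fun e => ?_⟩
  · have := h.aA; rw [e, h.aB] at this; norm_num at this
  · have := h.bB; rw [e, h.bC] at this; norm_num at this
  · have := h.cC; rw [e, h.cA] at this; norm_num at this

theorem sect {T T' : Tri} {a b c g : Pt → ℝ} (h : Coord T' a b c g)
    (hd : Disjoint T.outline T'.outline) {P Q : Pt} (hPQ : P ≠ Q)
    (ht : T.outline ∩ T'.hull = {P, Q}) :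
    P ∈ T'.int ∧ Q ∈ T'.int ∧ P ∈ T.outline ∧ Q ∈ T.outline ∧
      (∀ x ∈ T.hull, g x = 0 → H2 P Q x) := by
  have hP : P ∈ T.outline ∩ T'.hull := by rw [ht]; simp
  have hQ : Q ∈ T.outline ∩ T'.hull := by rw [ht]; simp
  have hall : ∀ x, x ∈ T.outline → x ∈ T'.hull → x = P ∨ x = Q := by
    intro x h1 h2
    have : x ∈ T.outline ∩ T'.hull := ⟨h1, h2⟩
    rw [ht] at this; simpa using this
  have iP : P ∈ T'.int := ⟨hP.2, fun h' => Set.disjoint_left.1 hd hP.1 h'⟩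
  have iQ : Q ∈ T'.int := ⟨hQ.2, fun h' => Set.disjoint_left.1 hd hQ.1 h'⟩
  refine ⟨iP, iQ, hP.1, hQ.1, ?_⟩
  have gP := ((h.int_iff P).1 iP).1
  have gQ := ((h.int_iff Q).1 iQ).1
  obtain ⟨nAB, nBC, nCA⟩ := T.ne
  have oAB : ∀ x, H2 T.A T.B x → x ∈ T.outline := fun x hx =>
    Or.inl (Or.inl ((mem_seg _ _ _).2 hx))
  have oBC : ∀ x, H2 T.B T.C x → x ∈ T.outline := fun x hx =>
    Or.inl (Or.inr ((mem_seg _ _ _).2 hx))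
  have oCA : ∀ x, H2 T.C T.A x → x ∈ T.outline := fun x hx =>
    Or.inr ((mem_seg _ _ _).2 hx)
  have key : ∀ V W, V ≠ W → (∀ x, H2 V W x → x ∈ T.outline) → (H2 V W P ∨ H2 V W Q) →
      ¬ (g V = 0 ∧ g W = 0) := by
    rintro V W hVW ho hor ⟨h1, h2⟩
    rcases hor with h3 | h3
    · exact edge_nd h iP h3 hVW h1 h2 (fun x hx hx' => hall x (ho x hx) hx')
    · exact edge_nd h iQ h3 hVW h1 h2 (fun x hx hx' => (hall x (ho x hx) hx').symm)
  have kAB := key _ _ nAB oAB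
  have kBC := key _ _ nBC oBC
  have kCA := key _ _ nCA oCA
  intro x hx hx0
  rw [Tri.hull, mem_hull3] at hx
  have eP : (H2 T.A T.B P ∨ H2 T.B T.C P) ∨ H2 T.C T.A P := by
    have := hP.1
    rwa [Tri.outline, Set.mem_union, Set.mem_union, mem_seg, mem_seg, mem_seg] at this
  have eQ : (H2 T.A T.B Q ∨ H2 T.B T.C Q) ∨ H2 T.C T.A Q := by
    have := hQ.1
    rwa [Tri.outline, Set.mem_union, Set.mem_union, mem_seg, mem_seg, mem_seg] at this
  rcases eP with (p | p) | p <;> rcases eQ with (q | q) | q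
  · exact absurd (uniq h.Ag p q gP gQ (kAB (Or.inl p))) hPQ
  · exact sect_core h.Ag p q hPQ gP gQ (kAB (Or.inl p)) (kBC (Or.inr q)) x hx hx0
  · exact (sect_core h.Ag q p hPQ.symm gQ gP (kCA (Or.inr q)) (kAB (Or.inl p)) x hx.rot.rot
      hx0).symm
  · exact (sect_core h.Ag q p hPQ.symm gQ gP (kAB (Or.inr q)) (kBC (Or.inl p)) x hx hx0).symm
  · exact absurd (uniq h.Ag p q gP gQ (kBC (Or.inl p))) hPQ
  · exact sect_core h.Ag p q hPQ gP gQ (kBC (Or.inl p)) (kCA (Or.inr q)) x hx.rot hx0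
  · exact sect_core h.Ag p q hPQ gP gQ (kCA (Or.inl p)) (kAB (Or.inr q)) x hx.rot.rot hx0
  · exact (sect_core h.Ag q p hPQ.symm gQ gP (kBC (Or.inr q)) (kCA (Or.inl p)) x hx.rot
      hx0).symm
  · exact absurd (uniq h.Ag p q gP gQ (kCA (Or.inl p))) hPQ

theorem two_pts {g α : Pt → ℝ} (hg : Aff g) (hα : Aff α) {A B C : Pt} (a1 : α A = 1)
    (a2 : α B = 0) (a3 : α C = 0) (hq : 0 < g B) (hp : g A ≤ 0) (hr : g C ≤ 0)
    (hn : ¬ (g A = 0 ∧ g C = 0)) :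
    ∃ P Q, P ≠ Q ∧ ∀ x, ((H2 A B x ∨ H2 B C x ∨ H2 C A x) ∧ g x = 0) ↔ (x = P ∨ x = Q) := by
  obtain ⟨P, hP, hP0⟩ := seg_zero hg (A := A) (C := B) (by nlinarith)
  obtain ⟨Q, hQ, hQ0⟩ := seg_zero hg (A := B) (C := C) (by nlinarith)
  have n1 : ¬ (g A = 0 ∧ g B = 0) := fun h => by linarith [h.2]
  have n2 : ¬ (g B = 0 ∧ g C = 0) := fun h => by linarith [h.1]
  refine ⟨P, Q, ?_, ?_⟩
  · intro e
    have hQa : α Q = 0 := by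
      obtain ⟨s, t, hs, ht, hst, rfl⟩ := hQ
      rw [hα.c2 hst, a2, a3]; ring
    obtain ⟨s, t, hs, ht, hst, hPe⟩ := hP
    rw [← e, hPe, hα.c2 hst, a1, a2] at hQa
    have s0 : s = 0 := by linarith
    have t1 : t = 1 := by linarith
    rw [hPe, hg.c2 hst, s0, t1] at hP0
    linarith
  · intro x
    constructor
    · rintro ⟨h | h | h, h0⟩
      · left; exact uniq hg h hP h0 hP0 n1
      · right; exact uniq hg h hQ h0 hQ0 n2
      · obtain ⟨s, t, hs, ht, hst, hx⟩ := h
        have h0' := h0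
        rw [hx, hg.c2 hst] at h0'
        have m1 := mul_nonneg hs (neg_nonneg.2 hr)
        have m2 := mul_nonneg ht (neg_nonneg.2 hp)
        have z1 : s * g C = 0 := by linarith
        have z2 : t * g A = 0 := by linarith
        rcases mul_eq_zero.1 z1 with s0 | c0
        · have t1 : t = 1 := by linarith
          left; refine uniq hg ⟨1, 0, by norm_num, le_rfl, by norm_num, ?_⟩ hP h0 hP0 n1
          rw [hx, s0, t1]; simp
        · rcases mul_eq_zero.1 z2 with t0 | c1
          · have s1 : s = 1 := by linarith
            right; refine uniq hg ⟨0, 1, le_rfl, by norm_num, by norm_num, ?_⟩ hQ h0 hQ0 n2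
            rw [hx, t0, s1]; simp
          · exact absurd ⟨c1, c0⟩ hn
    · rintro (rfl | rfl)
      · exact ⟨Or.inl hP, hP0⟩
      · exact ⟨Or.inr (Or.inl hQ), hQ0⟩

theorem sign_aux {a b c p q r : ℝ} (ha : 0 < a) (hb : 0 < b) (hc : 0 < c)
    (h0 : a * p + b * q + c * r = 0) (hn : ¬ (p = 0 ∧ q = 0 ∧ r = 0)) (hp : p ≤ 0) (hr : r ≤ 0) :
    0 < q ∧ ¬ (p = 0 ∧ r = 0) := by
  have m1 := mul_nonneg ha.le (neg_nonneg.2 hp)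
  have m2 := mul_nonneg hc.le (neg_nonneg.2 hr)
  have hq : 0 < q := by
    by_contra! hq
    have m3 := mul_nonneg hb.le (neg_nonneg.2 hq)
    have z1 : a * p = 0 := by linarith
    have z2 : b * q = 0 := by linarith
    have z3 : c * r = 0 := by linarith
    exact hn ⟨(mul_eq_zero.1 z1).resolve_left ha.ne', (mul_eq_zero.1 z2).resolve_left hb.ne',
      (mul_eq_zero.1 z3).resolve_left hc.ne'⟩
  refine ⟨hq, ?_⟩
  rintro ⟨rfl, rfl⟩
  have := mul_pos hb hq
  linarith

theorem two_pts_tri {T : Tri} {g : Pt → ℝ} (hg : Aff g) {Z : Pt} (hZ : Z ∈ T.int)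
    (hZ0 : g Z = 0) (hn : ¬ (g T.A = 0 ∧ g T.B = 0 ∧ g T.C = 0)) :
    ∃ P Q, P ≠ Q ∧ ∀ x, (x ∈ T.outline ∧ g x = 0) ↔ (x = P ∨ x = Q) := by
  obtain ⟨a, b, c, k, h⟩ := exists_coord T
  obtain ⟨z0, z1, z2, z3⟩ := (h.int_iff Z).1 hZ
  have hrep := h.rep0 z0
  have hsum : a Z * g T.A + b Z * g T.B + c Z * g T.C = 0 := by
    rw [← hg.c3 (h.sum Z), ← hrep, hZ0]
  have ho : ∀ x, x ∈ T.outline ↔ (H2 T.A T.B x ∨ H2 T.B T.C x ∨ H2 T.C T.A x) := by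
    intro x
    rw [Tri.outline, Set.mem_union, Set.mem_union, mem_seg, mem_seg, mem_seg, or_assoc]
  -- the statement for functions of a given sign pattern
  have main : ∀ f : Pt → ℝ, Aff f → (∀ x, f x = 0 ↔ g x = 0) →
      a Z * f T.A + b Z * f T.B + c Z * f T.C = 0 →
      ((f T.A ≤ 0 ∧ f T.C ≤ 0) ∨ (f T.B ≤ 0 ∧ f T.A ≤ 0) ∨ (f T.C ≤ 0 ∧ f T.B ≤ 0)) →
      ∃ P Q, P ≠ Q ∧ ∀ x, (x ∈ T.outline ∧ g x = 0) ↔ (x = P ∨ x = Q) := by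
    intro f hf hfg hs hor
    rw [← hfg, ← hfg, ← hfg] at hn
    rcases hor with ⟨u, v⟩ | ⟨u, v⟩ | ⟨u, v⟩
    · obtain ⟨w1, w2⟩ := sign_aux z1 z2 z3 hs hn u v
      obtain ⟨P, Q, e, hPQ⟩ := two_pts hf h.Aa h.aA h.aB h.aC w1 u v w2
      refine ⟨P, Q, e, fun x => ?_⟩
      rw [← hPQ, ho, hfg]
    · obtain ⟨w1, w2⟩ := sign_aux (p := f T.B) (q := f T.C) (r := f T.A) z2 z3 z1 (by linarith)
        (by tauto) u v
      obtain ⟨P, Q, e, hPQ⟩ := two_pts hf h.Ab h.bB h.bC h.bA w1 u v w2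
      refine ⟨P, Q, e, fun x => ?_⟩
      rw [← hPQ, ho, hfg]; tauto
    · obtain ⟨w1, w2⟩ := sign_aux (p := f T.C) (q := f T.A) (r := f T.B) z3 z1 z2 (by linarith)
        (by tauto) u v
      obtain ⟨P, Q, e, hPQ⟩ := two_pts hf h.Ac h.cC h.cA h.cB w1 u v w2
      refine ⟨P, Q, e, fun x => ?_⟩
      rw [← hPQ, ho, hfg]; tauto
  by_cases hor : (g T.A ≤ 0 ∧ g T.C ≤ 0) ∨ (g T.B ≤ 0 ∧ g T.A ≤ 0) ∨ (g T.C ≤ 0 ∧ g T.B ≤ 0)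
  · exact main g hg (fun _ => Iff.rfl) hsum hor
  · refine main (fun x => - g x) hg.neg (fun x => neg_eq_zero) (by linarith) ?_
    simp only [neg_nonpos]
    rcases le_total (g T.A) 0 with h1 | h1 <;> rcases le_total (g T.B) 0 with h2 | h2 <;>
      rcases le_total (g T.C) 0 with h3 | h3 <;> tauto

theorem ray_exit {T : Tri} {a b c g : Pt → ℝ} (h : Coord T a b c g) {O R D : Pt}
    (hO : O ∈ T.hull) (hc : g D = 0 ∨ 0 < g R * g D) :
    ∃ t : ℝ, 0 ≤ t ∧ (H3 T.A T.B D ((1 - t) • O + t • R) ∨ H3 T.A T.C D ((1 - t) • O + t • R) ∨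
      H3 T.B T.C D ((1 - t) • O + t • R)) := by
  obtain ⟨o0, o1, o2, o3⟩ := (h.hull_iff O).1 hO
  have hOr := h.rep0 o0
  have sO := h.sum O
  have sD := h.sum D
  have sR := h.sum R
  have fin : ∀ (Z : Pt) (p q r s : ℝ), 0 ≤ p → 0 ≤ q → 0 ≤ r → 0 ≤ s → p + q + r + s = 1 →
      (p = 0 ∨ q = 0 ∨ r = 0) → Z = p • T.A + q • T.B + r • T.C + s • D →
      (H3 T.A T.B D Z ∨ H3 T.A T.C D Z ∨ H3 T.B T.C D Z) := by
    rintro Z p q r s hp hq hr hs hsum (rfl | rfl | rfl) rfl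
    · right; right; exact ⟨q, r, s, hq, hr, hs, by linarith, by simp⟩
    · right; left; exact ⟨p, r, s, hp, hr, hs, by linarith, by simp⟩
    · left; exact ⟨p, q, s, hp, hq, hs, by linarith, by simp⟩
  rcases hc with hD | hRD
  · have hDr := h.rep0 hD
    obtain ⟨t, t0, -, e1, e2, e3, e4⟩ := exit_lemma (t₀ := 2) (p := - a D) (q := - b D)
      (r := - c D) o1 o2 o3 (by norm_num) (by
        by_contra! hcon
        linarith [hcon.1, hcon.2.1, hcon.2.2])
    refine ⟨0, le_rfl, fin _ _ _ _ t e1 e2 e3 t0 (by linear_combination sO - t * sD) e4 ?_⟩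
    linear_combination (norm := module) hOr - t • hDr
  · have hD : g D ≠ 0 := by rintro h; rw [h] at hRD; simp at hRD
    obtain ⟨m, hm⟩ : ∃ m, g R = m * g D := ⟨g R / g D, by field_simp⟩
    have hm0 : 0 < m := by
      rw [hm] at hRD
      have : 0 < m * (g D * g D) := by linarith
      exact (pos_iff_pos_of_mul_pos this).2 (mul_self_pos.2 hD)
    obtain ⟨N, hN⟩ := h.rep
    have hRr := hN R
    have hDr := hN D
    obtain ⟨t, t0, -, e1, e2, e3, e4⟩ := exit_lemma (t₀ := 2 / m) (p := a R - a O - m * a D)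
      (q := b R - b O - m * b D) (r := c R - c O - m * c D) o1 o2 o3 (by positivity) (by
        by_contra! hcon
        have : 2 / m * m = 2 := by field_simp
        have e : (a O + 2 / m * (a R - a O - m * a D)) + (b O + 2 / m * (b R - b O - m * b D)) +
            (c O + 2 / m * (c R - c O - m * c D)) = -1 := by
          linear_combination sO + 2 / m * (sR - sO) - 2 / m * m * sD - this
        linarith [hcon.1, hcon.2.1, hcon.2.2])
    refine ⟨t, t0, fin _ _ _ _ (t * m) e1 e2 e3 (by positivity)
      (by linear_combination sO + t * (sR - sO) - t * m * sD) e4 ?_⟩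
    rw [hm] at hRr
    linear_combination (norm := module) (1 - t) • hOr + t • hRr - (t * m) • hDr

theorem main_aux (T0 T1 T2 T0' : Tri)
    (h01 : Disjoint T0.outline T1.outline)
    (h12 : Disjoint T1.outline T2.outline)
    (h20 : Disjoint T2.outline T0.outline)
    (hcap : (T0.hull ∩ T1.hull ∩ T2.hull).Nonempty)
    (t0 : ∃ P Q : Pt, P ≠ Q ∧ T0.outline ∩ T1.hull = {P, Q})
    (t1 : ∃ P Q : Pt, P ≠ Q ∧ T1.outline ∩ T2.hull = {P, Q})
    (t2 : ∃ P Q : Pt, P ≠ Q ∧ T2.outline ∩ T0.hull = {P, Q})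
    (hA : T0'.A = T0.A) (hB : T0'.B = T0.B)
    (mA : ∀ x, H3 T0.A T0.C T0'.C x → x ∉ T1.outline ∧ x ∉ T2.outline)
    (mB : ∀ x, H3 T0.B T0.C T0'.C x → x ∉ T1.outline ∧ x ∉ T2.outline) :
    ∃ P Q : Pt, P ≠ Q ∧ T2.outline ∩ T0'.hull = {P, Q} := by
  obtain ⟨a0, b0, c0, g0, k0⟩ := exists_coord T0
  obtain ⟨a1, b1, c1, g1, k1⟩ := exists_coord T1
  obtain ⟨a2, b2, c2, g2, k2⟩ := exists_coord T2
  obtain ⟨a', b', c', g', k'⟩ := exists_coord T0'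
  obtain ⟨P0, Q0, n0, t0⟩ := t0
  obtain ⟨P1, Q1, n1, t1⟩ := t1
  obtain ⟨P2, Q2, n2, t2⟩ := t2
  obtain ⟨O, ⟨O0, O1⟩, O2⟩ := hcap
  obtain ⟨u1, u2, -, -, F0'⟩ := sect k1 h01 n0 t0
  obtain ⟨v1, v2, v3, v4, F1'⟩ := sect k2 h12 n1 t1
  obtain ⟨w1, w2, -, -, F2'⟩ := sect k0 h20 n2 t2
  have F0 : ∀ x ∈ T0.hull, g1 x = 0 → x ∈ T1.int := fun x hx h => int_conv u1 u2 (F0' x hx h)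
  have F1 : ∀ x ∈ T1.hull, g2 x = 0 → x ∈ T2.int := fun x hx h => int_conv v1 v2 (F1' x hx h)
  have F2 : ∀ x ∈ T2.hull, g0 x = 0 → x ∈ T0.int := fun x hx h => int_conv w1 w2 (F2' x hx h)
  have G0 : ∀ x ∈ T0.hull, g0 x = 0 := fun x hx => ((k0.hull_iff x).1 hx).1
  have G1 : ∀ x ∈ T1.hull, g1 x = 0 := fun x hx => ((k1.hull_iff x).1 hx).1
  have G2 : ∀ x ∈ T2.hull, g2 x = 0 := fun x hx => ((k2.hull_iff x).1 hx).1
  have OH : ∀ T : Tri, T.outline ⊆ T.hull := fun T x hx => by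
    obtain ⟨a, b, c, g, k⟩ := exists_coord T
    exact ((k.out_iff x).1 hx).1
  have iO1 : O ∈ T1.int := F0 O O0 (G1 O O1)
  have iO2 : O ∈ T2.int := F1 O O1 (G2 O O2)
  have hull0 : ∀ x, H3 T0.A T0.B T0.C x → x ∈ T0.hull := fun x hx => (mem_hull3 _ _ _ _).2 hx
  have hull0' : ∀ x, x ∈ T0'.hull ↔ H3 T0.A T0.B T0'.C x := fun x => by
    rw [Tri.hull, mem_hull3, hA, hB]
  -- faces with T1
  have trans1 : ∀ A : Pt, (∀ x, H3 A T0.C T0'.C x → x ∉ T1.outline ∧ x ∉ T2.outline) →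
      ∀ x y, H3 A T0.C T0'.C x → H3 A T0.C T0'.C y → g1 x = 0 → g1 y = 0 → y ∈ T1.int →
        x ∈ T1.int := by
    intro A m x y hx hy hx0 hy0 hyi
    refine ⟨?_, (m x hx).1⟩
    by_contra hcon
    obtain ⟨z, hz, hzo⟩ := cross k1 hyi.1 hx0 hcon
    exact (m z (H3.conv hy hx hz)).1 hzo
  have trans2 : ∀ A : Pt, (∀ x, H3 A T0.C T0'.C x → x ∉ T1.outline ∧ x ∉ T2.outline) →
      ∀ x y, H3 A T0.C T0'.C x → H3 A T0.C T0'.C y → g2 x = 0 → g2 y = 0 → y ∉ T2.hull →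
        x ∉ T2.hull := by
    intro A m x y hx hy hx0 hy0 hyi hxh
    obtain ⟨z, hz, hzo⟩ := cross k2 hxh hy0 hyi
    exact (m z (H3.conv hx hy hz)).2 hzo
  have O3 : H3 T0.A T0.B T0.C O := (mem_hull3 _ _ _ _).1 O0
  have e1A : ∀ y, H2 T0.A T0.C y → g1 y = 0 → y ∈ T1.int :=
    fun y hy h => F0 y (hull0 y (H3.outer hy)) h
  have e1B : ∀ y, H2 T0.B T0.C y → g1 y = 0 → y ∈ T1.int :=
    fun y hy h => F0 y (hull0 y (H3.right hy)) h
  have out0 : ∀ y ∈ T0.outline, y ∉ T2.hull := fun y hy h =>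
    (F2 y h (G0 y (OH T0 hy))).2 hy
  have e2A : ∀ y, H2 T0.A T0.C y → y ∉ T2.hull :=
    fun y hy => out0 y (Or.inr ((mem_seg _ _ _).2 hy.symm))
  have e2B : ∀ y, H2 T0.B T0.C y → y ∉ T2.hull :=
    fun y hy => out0 y (Or.inl (Or.inr ((mem_seg _ _ _).2 hy)))
  have e2C : ∀ y, H2 T0.A T0.B y → y ∉ T2.hull :=
    fun y hy => out0 y (Or.inl (Or.inl ((mem_seg _ _ _).2 hy)))
  have f1A : ∀ x, H3 T0.A T0.C T0'.C x → g1 x = 0 → x ∈ T1.int :=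
    conn k1.Ag (B := T0.B) (fun x => x ∈ T1.int) ⟨O, O3, G1 O O1⟩ e1A e1B (trans1 _ mA)
      (trans1 _ mB)
  have f1B : ∀ x, H3 T0.B T0.C T0'.C x → g1 x = 0 → x ∈ T1.int :=
    conn k1.Ag (B := T0.A) (fun x => x ∈ T1.int) ⟨O, O3.swap, G1 O O1⟩ e1B e1A (trans1 _ mB)
      (trans1 _ mA)
  have f2A : ∀ x, H3 T0.A T0.C T0'.C x → x ∉ T2.hull := fun x hx hxh =>
    conn k2.Ag (B := T0.B) (fun x => x ∉ T2.hull) ⟨O, O3, G2 O O2⟩ (fun y hy _ => e2A y hy)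
      (fun y hy _ => e2B y hy) (trans2 _ mA) (trans2 _ mB) x hx (G2 x hxh) hxh
  have f2B : ∀ x, H3 T0.B T0.C T0'.C x → x ∉ T2.hull := fun x hx hxh =>
    conn k2.Ag (B := T0.A) (fun x => x ∉ T2.hull) ⟨O, O3.swap, G2 O O2⟩ (fun y hy _ => e2B y hy)
      (fun y hy _ => e2A y hy) (trans2 _ mB) (trans2 _ mA) x hx (G2 x hxh) hxh
  -- the face ABC' with T1
  have f1C : ∀ x, H3 T0.A T0.B T0'.C x → g1 x = 0 → x ∈ T1.int :=
    two_dim k1.Ag (fun x => x ∈ T1.int) (fun x y z hx hy hz => int_conv hx hy hz)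
      (fun y hy h => F0 y (hull0 y (H3.left hy)) h) (fun y hy h => f1B y (H3.outer hy) h)
      (fun y hy h => f1A y (H3.outer hy) h)
  -- R and S
  have hORS : H2 P1 Q1 O := F1' O O1 (G2 O O2)
  have hlt : g0 P1 * g0 Q1 < 0 := by
    obtain ⟨s, t, hs, ht, hst, hOe⟩ := hORS
    have h0 := G0 O O0
    rw [hOe, k0.Ag.c2 hst] at h0
    have hs0 : s ≠ 0 := by
      rintro rfl
      have : t = 1 := by linarith
      rw [this] at hOe
      apply iO1.2
      rw [hOe]; simpa using v4
    have ht0 : t ≠ 0 := by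
      rintro rfl
      have : s = 1 := by linarith
      rw [this] at hOe
      apply iO1.2
      rw [hOe]; simpa using v3
    have sp : 0 < s := lt_of_le_of_ne hs hs0.symm
    have tp : 0 < t := lt_of_le_of_ne ht ht0.symm
    have hP : g0 P1 ≠ 0 := by
      intro hz
      exact (F0 P1 (F2 P1 v1.1 hz).1 (G1 P1 (OH _ v3))).2 v3
    have e : s * (g0 P1 * g0 Q1) = - (t * (g0 Q1 * g0 Q1)) := by linear_combination g0 Q1 * h0
    have e' : s * (g0 P1 * g0 P1) = - (t * (g0 P1 * g0 Q1)) := by linear_combination g0 P1 * h0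
    have : 0 < s * (g0 P1 * g0 P1) := mul_pos sp (mul_self_pos.2 hP)
    by_contra! hcon
    have := mul_nonneg ht hcon
    linarith
  obtain ⟨R, R1, R2, hRD⟩ : ∃ R, R ∈ T1.outline ∧ R ∈ T2.int ∧
      (g0 T0'.C = 0 ∨ 0 < g0 R * g0 T0'.C) := by
    by_cases hD : g0 T0'.C = 0
    · exact ⟨P1, v3, v1, Or.inl hD⟩
    · by_cases hpos : 0 < g0 P1 * g0 T0'.C
      · exact ⟨P1, v3, v1, Or.inr hpos⟩
      · refine ⟨Q1, v4, v2, Or.inr ?_⟩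
        push Not at hpos
        have hQ : g0 Q1 ≠ 0 := by rintro h; rw [h] at hlt; simp at hlt
        have hP : g0 P1 ≠ 0 := by rintro h; rw [h] at hlt; simp at hlt
        have hlt2 : g0 P1 * g0 T0'.C < 0 := lt_of_le_of_ne hpos (mul_ne_zero hP hD)
        have h5 := mul_pos_of_neg_of_neg hlt hlt2
        have h6 : 0 < (g0 P1 * g0 P1) * (g0 Q1 * g0 T0'.C) := by linarith
        exact (pos_iff_pos_of_mul_pos h6).1 (mul_self_pos.2 hP)
  have hR1 : g1 R = 0 := G1 R (OH _ R1)
  obtain ⟨t, ht, hZ⟩ := ray_exit k0 O0 hRD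
  set Z := (1 - t) • O + t • R with hZdef
  have hst : (1 - t) + t = 1 := by ring
  have gZ1 : g1 Z = 0 := by rw [hZdef, k1.Ag.c2 hst, hR1, G1 O O1]; ring
  have hZ1 : Z ∈ T1.int := by
    rcases hZ with h | h | h
    · exact f1C Z h gZ1
    · exact f1A Z h gZ1
    · exact f1B Z h gZ1
  have ht1 : t < 1 := by
    by_contra! hcon
    have hRi : R ∈ T1.int := by
      refine int_conv iO1 hZ1 ⟨1 - 1 / t, 1 / t, ?_, by positivity, by ring, ?_⟩
      · rw [sub_nonneg, div_le_one (by linarith)]; exact hcon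
      · have : t ≠ 0 := by linarith
        rw [hZdef]
        match_scalars <;> field_simp <;> ring
    exact hRi.2 R1
  have hZ2 : Z ∈ T2.int := int_conv iO2 R2 ⟨1 - t, t, by linarith, ht, hst, rfl⟩
  have hZ' : Z ∈ T0'.hull := by
    rcases hZ with h | h | h
    · exact (hull0' Z).2 h
    · exact absurd hZ2.1 (f2A Z h)
    · exact absurd hZ2.1 (f2B Z h)
  have hout' : ∀ x ∈ T0'.outline, x ∉ T2.hull := by
    intro x hx
    rw [Tri.outline, Set.mem_union, Set.mem_union, mem_seg, mem_seg, mem_seg, hA, hB] at hx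
    rcases hx with (hx | hx) | hx
    · exact e2C x hx
    · exact f2B x (H3.outer hx)
    · exact f2A x (H3.outer hx.symm)
  have hin : ∀ x ∈ T2.hull, g' x = 0 → x ∈ T0'.hull := by
    intro x hx hx0
    by_contra hcon
    obtain ⟨z, hz, hzo⟩ := cross k' hZ' hx0 hcon
    refine hout' z hzo ?_
    rw [Tri.hull, mem_hull3] at hx ⊢
    exact H3.conv ((mem_hull3 _ _ _ _).1 hZ2.1) hx hz
  have hn : ¬ (g' T2.A = 0 ∧ g' T2.B = 0 ∧ g' T2.C = 0) := by
    rintro ⟨z1, z2, z3⟩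
    have hR' : g' R = 0 := by
      obtain ⟨p, q, r, -, -, -, hs, hRe⟩ := (mem_hull3 _ _ _ _).1 R2.1
      rw [hRe, k'.Ag.c3 hs, z1, z2, z3]; ring
    have := hin R R2.1 hR'
    exact (f1C R ((hull0' R).1 this) hR1).2 R1
  obtain ⟨P, Q, hPQ, hiff⟩ := two_pts_tri k'.Ag hZ2 ((k'.hull_iff Z).1 hZ').1 hn
  refine ⟨P, Q, hPQ, ?_⟩
  ext x
  rw [Set.mem_insert_iff, Set.mem_singleton_iff, ← hiff]
  constructor
  · rintro ⟨h1, h2⟩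
    exact ⟨h1, ((k'.hull_iff x).1 h2).1⟩
  · rintro ⟨h1, h2⟩
    exact ⟨h1, hin x (OH _ h1) h2⟩

/-- After an elementary move of `Δ0 = ABC` to `Δ0' = ABC'` in a Borromean configuration,
`∂Δ2 ∩ ⟨Δ0'⟩` consists of exactly two points. -/
theorem stmt18 (Δ0 Δ1 Δ2 : Tri)
    (h01 : Disjoint Δ0.outline Δ1.outline)
    (h12 : Disjoint Δ1.outline Δ2.outline)
    (h20 : Disjoint Δ2.outline Δ0.outline)
    (hcap : (Δ0.hull ∩ Δ1.hull ∩ Δ2.hull).Nonempty)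
    (t0 : ∃ P Q : Pt, P ≠ Q ∧ Δ0.outline ∩ Δ1.hull = {P, Q})
    (t1 : ∃ P Q : Pt, P ≠ Q ∧ Δ1.outline ∩ Δ2.hull = {P, Q})
    (t2 : ∃ P Q : Pt, P ≠ Q ∧ Δ2.outline ∩ Δ0.hull = {P, Q})
    (C' : Pt) (hC' : C' ∉ affineSpan ℝ ({Δ0.A, Δ0.B} : Set Pt))
    (hmove : (convexHull ℝ ({Δ0.A, Δ0.C, C'} : Set Pt) ∪
        convexHull ℝ ({Δ0.B, Δ0.C, C'} : Set Pt)) ∩ (Δ1.outline ∪ Δ2.outline) = ∅)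
    (Δ0' : Tri) (hA : Δ0'.A = Δ0.A) (hB : Δ0'.B = Δ0.B) (hC : Δ0'.C = C') :
    ∃ P Q : Pt, P ≠ Q ∧ Δ2.outline ∩ Δ0'.hull = {P, Q} := by
  have hm : ∀ x, (H3 Δ0.A Δ0.C C' x ∨ H3 Δ0.B Δ0.C C' x) → x ∉ Δ1.outline ∧ x ∉ Δ2.outline := by
    intro x hx
    rw [← mem_hull3, ← mem_hull3] at hx
    have key : ¬ (x ∈ Δ1.outline ∪ Δ2.outline) := by
      intro h
      have : x ∈ (∅ : Set Pt) := by rw [← hmove]; exact ⟨hx, h⟩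
      exact this
    exact ⟨fun h => key (Or.inl h), fun h => key (Or.inr h)⟩
  subst hC
  exact main_aux Δ0 Δ1 Δ2 Δ0' h01 h12 h20 hcap t0 t1 t2 hA hB
    (fun x hx => hm x (Or.inl hx)) (fun x hx => hm x (Or.inr hx))
end
end

section
/- Let Δ0 = ABC, Δ1, Δ2 be triangles in ℝ³ with pairwise disjoint outlines such that ⟨Δ0⟩ ∩ ⟨Δ1⟩ ∩ ⟨Δ2⟩ ≠ ∅ and for each j ∈ {0,1,2} the set ∂Δj ∩ ⟨Δ_{(j+1) mod 3}⟩ consists of exactly two points. Let C' be a point not on the line AB such that (⟨A,C,C'⟩ ∪ ⟨B,C,C'⟩) ∩ (∂Δ1 ∪ ∂Δ2) = ∅, and let Δ0' = ABC'. Then ⟨Δ0'⟩ ∩ ⟨Δ1⟩ ∩ ⟨Δ2⟩ ≠ ∅. -/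
open scoped Matrix

noncomputable section

theorem baryAux (A B C : Pt) (h : AffineIndependent ℝ ![A, B, C]) :
    ∃ f l1 l2 l3 : Pt →ᵃ[ℝ] ℝ, (f A = 0 ∧ f B = 0 ∧ f C = 0) ∧
      (l1 A = 1 ∧ l1 B = 0 ∧ l1 C = 0) ∧ (l2 A = 0 ∧ l2 B = 1 ∧ l2 C = 0) ∧
      (l3 A = 0 ∧ l3 B = 0 ∧ l3 C = 1) ∧ (∀ x, l1 x + l2 x + l3 x = 1) ∧
      ∀ x, f x = 0 → x = l1 x • A + l2 x • B + l3 x • C := by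
  have hli : LinearIndependent ℝ ![B - A, C - A] := by
    have := (affineIndependent_iff_linearIndependent_vsub ℝ _ (0 : Fin 3)).1 h
    have h2 := this.comp (![⟨1, by decide⟩, ⟨2, by decide⟩] : Fin 2 → {x : Fin 3 // x ≠ 0})
      (by intro i j; fin_cases i <;> fin_cases j <;> simp)
    have e : ![B - A, C - A] = (fun i : {x : Fin 3 // x ≠ 0} => (![A, B, C] i -ᵥ ![A, B, C] 0 : Pt)) ∘
        (![⟨1, by decide⟩, ⟨2, by decide⟩] : Fin 2 → {x : Fin 3 // x ≠ 0}) := by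
      funext i; fin_cases i <;> simp
    rw [e]; exact h2
  obtain ⟨N, hN⟩ := exists_linearIndependent_cons_of_lt_finrank (R := ℝ) (M := Pt) hli (by simp)
  let b := basisOfLinearIndependentOfCardEqFinrank hN (by simp)
  have hb0 : b 0 = N := by simp [b]
  have hb1 : b 1 = B - A := by
    simp only [b, coe_basisOfLinearIndependentOfCardEqFinrank]; rfl
  have hb2 : b 2 = C - A := by
    simp only [b, coe_basisOfLinearIndependentOfCardEqFinrank]; rfl
  let s : Pt →ᵃ[ℝ] Pt := AffineMap.id ℝ Pt - AffineMap.const ℝ Pt A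
  let g : Fin 3 → (Pt →ᵃ[ℝ] ℝ) := fun i => (b.coord i).toAffineMap.comp s
  have hgA : ∀ i, g i A = 0 := by intro i; simp [g, s]
  have hgB : ∀ i, g i B = if i = 1 then 1 else 0 := by
    intro i; simp [g, s, ← hb1, Finsupp.single_apply, eq_comm]
  have hgC : ∀ i, g i C = if i = 2 then 1 else 0 := by
    intro i; simp [g, s, ← hb2, Finsupp.single_apply, eq_comm]
  have hx : ∀ x, x - A = g 0 x • N + g 1 x • (B - A) + g 2 x • (C - A) := by
    intro x
    have := b.sum_repr (x - A)
    rw [Fin.sum_univ_three, hb0, hb1, hb2] at this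
    rw [← this]; simp [g, s]
  refine ⟨g 0, AffineMap.const ℝ Pt 1 - g 1 - g 2, g 1, g 2, ?_, ?_, ?_, ?_, ?_, ?_⟩
  · simp [hgA, hgB, hgC]
  · simp [hgA, hgB, hgC]
  · simp [hgA, hgB, hgC]
  · simp [hgA, hgB, hgC]
  · intro x; simp; ring
  · intro x h0
    have := hx x
    rw [h0] at this
    rw [sub_eq_iff_eq_add] at this
    conv_lhs => rw [this]
    simp
    module

theorem aff2 (f : Pt →ᵃ[ℝ] ℝ) (A B : Pt) (a b : ℝ) (h : a + b = 1) :
    f (a • A + b • B) = a * f A + b * f B := by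
  rw [AffineMap.decomp]
  simp
  linear_combination - (f 0) * h

theorem aff3 (f : Pt →ᵃ[ℝ] ℝ) (A B C : Pt) (a b c : ℝ) (h : a + b + c = 1) :
    f (a • A + b • B + c • C) = a * f A + b * f B + c * f C := by
  rw [AffineMap.decomp]
  simp
  linear_combination - (f 0) * h

theorem aff4 (f : Pt →ᵃ[ℝ] ℝ) (A B C D : Pt) (a b c d : ℝ) (h : a + b + c + d = 1) :
    f (a • A + b • B + c • C + d • D) = a * f A + b * f B + c * f C + d * f D := by
  rw [AffineMap.decomp]
  simp
  linear_combination - (f 0) * h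

theorem comb3 {s : Set Pt} (hs : Convex ℝ s) {A B C : Pt} (hA : A ∈ s) (hB : B ∈ s) (hC : C ∈ s)
    {a b c : ℝ} (ha : 0 ≤ a) (hb : 0 ≤ b) (hc : 0 ≤ c) (h : a + b + c = 1) :
    a • A + b • B + c • C ∈ s := by
  have := hs.sum_mem (t := Finset.univ) (w := ![a, b, c]) (z := ![A, B, C])
    (by intro i _; fin_cases i <;> simpa) (by simpa [Fin.sum_univ_three] using h)
    (by intro i _; fin_cases i <;> simpa)
  simpa [Fin.sum_univ_three] using this

theorem comb4 {s : Set Pt} (hs : Convex ℝ s) {A B C D : Pt} (hA : A ∈ s) (hB : B ∈ s) (hC : C ∈ s)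
    (hD : D ∈ s) {a b c d : ℝ} (ha : 0 ≤ a) (hb : 0 ≤ b) (hc : 0 ≤ c) (hd : 0 ≤ d)
    (h : a + b + c + d = 1) :
    a • A + b • B + c • C + d • D ∈ s := by
  have := hs.sum_mem (t := Finset.univ) (w := ![a, b, c, d]) (z := ![A, B, C, D])
    (by intro i _; fin_cases i <;> simpa) (by simpa [Fin.sum_univ_four] using h)
    (by intro i _; fin_cases i <;> simpa)
  simpa [Fin.sum_univ_four] using this

theorem mem_hull3_s19 {A B C x : Pt} (hx : x ∈ convexHull ℝ ({A, B, C} : Set Pt)) :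
    ∃ a b c : ℝ, 0 ≤ a ∧ 0 ≤ b ∧ 0 ≤ c ∧ a + b + c = 1 ∧ x = a • A + b • B + c • C := by
  rw [convexHull_insert (by simp), mem_convexJoin] at hx
  obtain ⟨A', hA', y, hy, hx⟩ := hx
  rw [Set.mem_singleton_iff] at hA'
  subst hA'
  rw [convexHull_pair] at hy
  obtain ⟨p, q, hp, hq, hpq, rfl⟩ := hy
  obtain ⟨r, t, hr, ht, hrt, rfl⟩ := hx
  refine ⟨r, t * p, t * q, hr, by positivity, by positivity, ?_, ?_⟩
  · linear_combination hrt + t * hpq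
  · module

/-- First exit for three affine coordinates. -/
theorem exit3 (y z : Fin 3 → ℝ) (hy : ∀ i, 0 ≤ y i) (hz : ∃ i, z i < 0) :
    ∃ t : ℝ, 0 ≤ t ∧ t ≤ 1 ∧ (∀ i, 0 ≤ (1 - t) * y i + t * z i) ∧
      ∃ i, (1 - t) * y i + t * z i = 0 := by
  let m : ℝ → ℝ := fun t => min ((1 - t) * y 0 + t * z 0)
    (min ((1 - t) * y 1 + t * z 1) ((1 - t) * y 2 + t * z 2))
  have hc : ContinuousOn m (Set.Icc 0 1) := by
    apply Continuous.continuousOn; fun_prop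
  have h1 : m 1 ≤ 0 := by
    obtain ⟨i, hi⟩ := hz
    simp only [m, min_le_iff]
    fin_cases i <;> simp at hi ⊢ <;> grind
  have h0 : 0 ≤ m 0 := by simp [m, hy]
  obtain ⟨t, ⟨ht0, ht1⟩, ht⟩ := intermediate_value_Icc' (zero_le_one) hc ⟨h1, h0⟩
  have hle : ∀ i, 0 ≤ (1 - t) * y i + t * z i := by
    have := ht.ge
    simp only [m, le_min_iff] at this
    intro i; fin_cases i
    · exact this.1
    · exact this.2.1
    · exact this.2.2
  refine ⟨t, ht0, ht1, hle, ?_⟩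
  by_contra! hne
  have : 0 < m t := by
    simp only [m, lt_min_iff]
    exact ⟨(hle 0).lt_of_ne' (hne 0), (hle 1).lt_of_ne' (hne 1), (hle 2).lt_of_ne' (hne 2)⟩
  exact this.ne' ht

structure TD (H O : Set Pt) where
  f : Pt →ᵃ[ℝ] ℝ
  l : Fin 3 → (Pt →ᵃ[ℝ] ℝ)
  hH : ∀ x, x ∈ H ↔ f x = 0 ∧ ∀ i, 0 ≤ l i x
  hO : ∀ x, x ∈ O ↔ f x = 0 ∧ (∀ i, 0 ≤ l i x) ∧ ∃ i, l i x = 0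

theorem exTD (T : Tri) : Nonempty (TD T.hull T.outline) := by
  obtain ⟨f, l1, l2, l3, ⟨fA, fB, fC⟩, ⟨aA, aB, aC⟩, ⟨bA, bB, bC⟩, ⟨cA, cB, cC⟩, hs, hx⟩ :=
    baryAux T.A T.B T.C T.indep
  refine ⟨⟨f, ![l1, l2, l3], ?_, ?_⟩⟩
  · intro x
    constructor
    · intro h
      obtain ⟨a, b, c, ha, hb, hc, h1, rfl⟩ := mem_hull3_s19 h
      refine ⟨by rw [aff3 _ _ _ _ _ _ _ h1]; simp [fA, fB, fC], ?_⟩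
      intro i
      fin_cases i <;> simp [aff3 _ _ _ _ _ _ _ h1, fA, fB, fC, aA, aB, aC, bA, bB, bC, cA, cB, cC, ha, hb, hc]
    · rintro ⟨h0, h⟩
      rw [hx x h0]
      exact comb3 (convex_convexHull _ _) (subset_convexHull _ _ (by simp))
        (subset_convexHull _ _ (by simp)) (subset_convexHull _ _ (by simp)) (h 0) (h 1) (h 2) (hs x)
  · intro x
    constructor
    · rintro ((⟨a, b, ha, hb, h1, rfl⟩ | ⟨a, b, ha, hb, h1, rfl⟩) | ⟨a, b, ha, hb, h1, rfl⟩)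
      · refine ⟨by simp [aff2 _ _ _ _ _ h1, fA, fB, fC, aA, aB, aC, bA, bB, bC, cA, cB, cC, ha, hb], ?_, 2, by simp [aff2 _ _ _ _ _ h1, fA, fB, fC, aA, aB, aC, bA, bB, bC, cA, cB, cC, ha, hb]⟩
        intro i
        fin_cases i <;> simp [aff2 _ _ _ _ _ h1, fA, fB, fC, aA, aB, aC, bA, bB, bC, cA, cB, cC, ha, hb]
      · refine ⟨by simp [aff2 _ _ _ _ _ h1, fA, fB, fC, aA, aB, aC, bA, bB, bC, cA, cB, cC, ha, hb], ?_, 0, by simp [aff2 _ _ _ _ _ h1, fA, fB, fC, aA, aB, aC, bA, bB, bC, cA, cB, cC, ha, hb]⟩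
        intro i
        fin_cases i <;> simp [aff2 _ _ _ _ _ h1, fA, fB, fC, aA, aB, aC, bA, bB, bC, cA, cB, cC, ha, hb]
      · refine ⟨by simp [aff2 _ _ _ _ _ h1, fA, fB, fC, aA, aB, aC, bA, bB, bC, cA, cB, cC, ha, hb], ?_, 1, by simp [aff2 _ _ _ _ _ h1, fA, fB, fC, aA, aB, aC, bA, bB, bC, cA, cB, cC, ha, hb]⟩
        intro i
        fin_cases i <;> simp [aff2 _ _ _ _ _ h1, fA, fB, fC, aA, aB, aC, bA, bB, bC, cA, cB, cC, ha, hb]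
    · rintro ⟨h0, h, i, hi⟩
      have e := hx x h0
      have e1 := hs x
      have g0 : 0 ≤ l1 x := h 0
      have g1 : 0 ≤ l2 x := h 1
      have g2 : 0 ≤ l3 x := h 2
      fin_cases i
      · replace hi : l1 x = 0 := hi
        refine Or.inl (Or.inr ⟨l2 x, l3 x, g1, g2, by linarith, ?_⟩)
        conv_rhs => rw [e, hi]
        simp
      · replace hi : l2 x = 0 := hi
        refine Or.inr ⟨l3 x, l1 x, g2, g0, by linarith, ?_⟩
        conv_rhs => rw [e, hi]
        simp [add_comm]
      · replace hi : l3 x = 0 := hi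
        refine Or.inl (Or.inl ⟨l1 x, l2 x, g0, g1, by linarith, ?_⟩)
        conv_rhs => rw [e, hi]
        simp

theorem TD.seg {H O : Set Pt} (D : TD H O) {y z : Pt} (hy : y ∈ H) (hz : D.f z = 0)
    (h : ∀ p ∈ segment ℝ y z, p ∉ O) : z ∈ H := by
  rw [D.hH] at hy ⊢
  refine ⟨hz, ?_⟩
  by_contra! hc
  obtain ⟨t, h0, h1, ha, i, hi⟩ := exit3 (fun i => D.l i y) (fun i => D.l i z) hy.2 hc
  refine h ((1 - t) • y + t • z) ⟨1 - t, t, by linarith, h0, by ring, rfl⟩ ?_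
  rw [D.hO]
  have e : (1 - t) + t = 1 := by ring
  simp only [aff2 _ _ _ _ _ e]
  exact ⟨by rw [hy.1, hz]; simp, ha, i, hi⟩

theorem exZero (f : Pt →ᵃ[ℝ] ℝ) {x y : Pt} (h : f x * f y ≤ 0) : ∃ z ∈ segment ℝ x y, f z = 0 := by
  by_cases h0 : f x = 0
  · exact ⟨x, left_mem_segment _ _ _, h0⟩
  · have hx : 0 < f x ^ 2 := by positivity
    have hd : 0 < f x ^ 2 - f x * f y := by linarith
    have e : (- (f x * f y) / (f x ^ 2 - f x * f y)) + (f x ^ 2 / (f x ^ 2 - f x * f y)) = 1 := by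
      rw [← add_div, div_eq_one_iff_eq hd.ne']; ring
    refine ⟨_, ⟨_, _, div_nonneg (by linarith) hd.le, div_nonneg hx.le hd.le, e, rfl⟩, ?_⟩
    rw [aff2 _ _ _ _ _ e]
    field_simp; ring

theorem segSign (f : Pt →ᵃ[ℝ] ℝ) {x y z : Pt} (hz : z ∈ segment ℝ x y) (h : f z = 0) :
    f x * f y ≤ 0 := by
  obtain ⟨a, b, ha, hb, h1, rfl⟩ := hz
  rw [aff2 _ _ _ _ _ h1] at h
  by_contra! hc
  have h2 : a * f x ^ 2 + b * (f x * f y) = 0 := by linear_combination (f x) * h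
  have h3 : a * (f x * f y) + b * (f y) ^ 2 = 0 := by linear_combination (f y) * h
  have : (a + b) * (f x * f y) ≤ 0 := by nlinarith [mul_nonneg ha (sq_nonneg (f x)), mul_nonneg hb (sq_nonneg (f y))]
  rw [h1] at this
  linarith

theorem posConv (f : Pt →ᵃ[ℝ] ℝ) (s : Set Pt) (h : ∀ p ∈ s, 0 < f p) :
    ∀ x ∈ convexHull ℝ s, 0 < f x := by
  have hc : Convex ℝ (f ⁻¹' Set.Ioi 0) := (convex_Ioi 0).affine_preimage f
  exact fun x hx => convexHull_min (t := f ⁻¹' Set.Ioi 0) h hc hx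

theorem posHull (s : Finset Pt) (f l : Pt →ᵃ[ℝ] ℝ)
    (h : ∀ p ∈ s, ∀ q ∈ s, ∀ Y ∈ segment ℝ p q, f Y = 0 → 0 < l Y) :
    ∀ X ∈ convexHull ℝ (s : Set Pt), f X = 0 → 0 < l X := by
  classical
  intro X hX hf
  obtain ⟨m, hlo, hhi⟩ := Order.exists_between_finsets
    ((s.filter (fun p => 0 < f p)).image (fun p => - l p / f p))
    ((s.filter (fun p => f p < 0)).image (fun p => - l p / f p)) (by
      intro x hx y hy
      simp only [Finset.mem_image, Finset.mem_filter] at hx hy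
      obtain ⟨p, ⟨hp, hfp⟩, rfl⟩ := hx
      obtain ⟨q, ⟨hq, hfq⟩, rfl⟩ := hy
      have hd : 0 < f p - f q := by linarith
      have e : (- f q / (f p - f q)) + f p / (f p - f q) = 1 := by field_simp; ring
      have := h p hp q hq _ ⟨_, _, div_nonneg (by linarith) hd.le, div_nonneg hfp.le hd.le, e, rfl⟩
        (by rw [aff2 _ _ _ _ _ e]; field_simp; ring)
      rw [aff2 _ _ _ _ _ e] at this
      have h2 : 0 < - f q * l p + f p * l q := by
        have h3 := mul_pos this hd
        have : (-f q / (f p - f q) * l p + f p / (f p - f q) * l q) * (f p - f q) =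
          - f q * l p + f p * l q := by field_simp
        linarith
      rw [← neg_div_neg_eq (- l q), div_lt_div_iff₀ hfp (by linarith)]
      linarith)
  have key : 0 < (l + m • f) X := by
    refine posConv (l + m • f) s ?_ X hX
    intro p hp
    simp only [AffineMap.coe_add, AffineMap.coe_smul, Pi.add_apply, Pi.smul_apply, smul_eq_mul]
    rcases lt_trichotomy (f p) 0 with h0 | h0 | h0
    · have := hhi (- l p / f p) (Finset.mem_image.2 ⟨p, by simp [Finset.mem_coe.1 hp, h0], rfl⟩)
      rw [lt_div_iff_of_neg h0] at this
      linarith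
    · have := h p hp p hp p (left_mem_segment _ _ _) h0
      rw [h0]; linarith
    · have := hlo (- l p / f p) (Finset.mem_image.2 ⟨p, by simp [Finset.mem_coe.1 hp, h0], rfl⟩)
      rw [div_lt_iff₀ h0] at this
      linarith
  simpa [hf] using key

theorem TD.inner {H O : Set Pt} (D : TD H O) (x : Pt) :
    (x ∈ H ∧ x ∉ O) ↔ (D.f x = 0 ∧ ∀ i, 0 < D.l i x) := by
  rw [D.hH, D.hO]
  constructor
  · rintro ⟨⟨h0, h1⟩, h2⟩
    refine ⟨h0, fun i => (h1 i).lt_of_ne' fun h => h2 ⟨h0, h1, i, h⟩⟩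
  · rintro ⟨h0, h1⟩
    exact ⟨⟨h0, fun i => (h1 i).le⟩, fun ⟨_, _, i, hi⟩ => (h1 i).ne' hi⟩

theorem TD.hullIn {H O : Set Pt} (D : TD H O) (s : Finset Pt)
    (h : ∀ p ∈ s, ∀ q ∈ s, ∀ Y ∈ segment ℝ p q, D.f Y = 0 → Y ∈ H ∧ Y ∉ O) :
    ∀ X ∈ convexHull ℝ (s : Set Pt), D.f X = 0 → X ∈ H ∧ X ∉ O := by
  intro X hX hf
  rw [D.inner]
  exact ⟨hf, fun i => posHull s D.f (D.l i)
    (fun p hp q hq Y hY hfY => ((D.inner Y).1 (h p hp q hq Y hY hfY)).2 i) X hX hf⟩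

theorem segSub {a b x y : Pt} (hx : x ∈ segment ℝ a b) (hy : y ∈ segment ℝ a b) :
    segment ℝ x y ⊆ segment ℝ a b := (convex_segment a b).segment_subset hx hy

theorem edgesIn (S : Tri) {H O : Set Pt} (D : TD H O) (hd : Disjoint S.outline O)
    {P Q : Pt} (hPQ : P ≠ Q) (hI : S.outline ∩ H = {P, Q}) :
    ∀ Y ∈ S.outline, D.f Y = 0 → Y ∈ H := by
  have fH : ∀ x ∈ H, D.f x = 0 := fun x hx => ((D.hH x).1 hx).1
  have hP : P ∈ S.outline ∩ H := by rw [hI]; simp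
  have hQ : Q ∈ S.outline ∩ H := by rw [hI]; simp
  have prop : ∀ x y, segment ℝ x y ⊆ S.outline → D.f y = 0 → x ∈ H → y ∈ H :=
    fun x y hs hy hx => D.seg hx hy fun p hp => Set.disjoint_left.1 hd (hs hp)
  have noPQ : ¬ segment ℝ P Q ⊆ S.outline := by
    intro hs
    have e : (1 / 2 : ℝ) + 1 / 2 = 1 := by norm_num
    have hm : (1 / 2 : ℝ) • P + (1 / 2 : ℝ) • Q ∈ segment ℝ P Q :=
      ⟨_, _, by norm_num, by norm_num, e, rfl⟩
    have hm2 : (1 / 2 : ℝ) • P + (1 / 2 : ℝ) • Q ∈ H := by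
      refine prop P _ (((convex_segment P Q).segment_subset (left_mem_segment _ _ _) hm).trans hs) ?_ hP.2
      rw [aff2 _ _ _ _ _ e, fH P hP.2, fH Q hQ.2]; simp
    have : (1 / 2 : ℝ) • P + (1 / 2 : ℝ) • Q ∈ ({P, Q} : Set Pt) := hI ▸ ⟨hs hm, hm2⟩
    apply hPQ
    rcases this with h | h
    · have h := congrArg (fun v => (2 : ℝ) • v - P) h
      simp [smul_smul] at h
      rw [two_smul] at h
      simpa using h.symm
    · have h := congrArg (fun v => (2 : ℝ) • v - Q) h
      simp [smul_smul] at h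
      rw [two_smul] at h
      simpa using h
  have gen : ∀ U V W Y, segment ℝ U V ⊆ S.outline → segment ℝ V W ⊆ S.outline →
      segment ℝ W U ⊆ S.outline → P ∈ segment ℝ U V → Q ∈ segment ℝ V W →
      Y ∈ segment ℝ W U → D.f Y = 0 → Y ∈ H := by
    intro U V W Y h1 h2 h3 hPe hQe hYe hY
    have s1 := segSign D.f hPe (fH P hP.2)
    have s2 := segSign D.f hQe (fH Q hQ.2)
    have s3 := segSign D.f hYe hY
    by_cases hU : D.f U = 0
    · exact prop U Y ((segSub (right_mem_segment _ _ _) hYe).trans h3) hY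
        (prop P U ((segSub hPe (left_mem_segment _ _ _)).trans h1) hU hP.2)
    by_cases hW : D.f W = 0
    · exact prop W Y ((segSub (left_mem_segment _ _ _) hYe).trans h3) hY
        (prop Q W ((segSub hQe (right_mem_segment _ _ _)).trans h2) hW hQ.2)
    by_cases hV : D.f V = 0
    · exfalso
      have hVH := prop P V ((segSub hPe (right_mem_segment _ _ _)).trans h1) hV hP.2
      have : V ∈ ({P, Q} : Set Pt) := hI ▸ ⟨h1 (right_mem_segment _ _ _), hVH⟩
      rcases this with h | h
      · subst h
        exact noPQ ((segSub (left_mem_segment _ _ _) hQe).trans h2)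
      · rw [Set.mem_singleton_iff] at h
        subst h
        exact noPQ ((segSub hPe (right_mem_segment _ _ _)).trans h1)
    exfalso
    have t1 := s1.lt_of_ne (mul_ne_zero hU hV)
    have t2 := s2.lt_of_ne (mul_ne_zero hV hW)
    have t3 := s3.lt_of_ne (mul_ne_zero hW hU)
    have := mul_pos_of_neg_of_neg t1 t2
    nlinarith [sq_nonneg (D.f U * D.f V * D.f W), mul_neg_of_pos_of_neg this t3]
  have e1 : segment ℝ S.A S.B ⊆ S.outline := fun x hx => Or.inl (Or.inl hx)
  have e2 : segment ℝ S.B S.C ⊆ S.outline := fun x hx => Or.inl (Or.inr hx)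
  have e3 : segment ℝ S.C S.A ⊆ S.outline := fun x hx => Or.inr hx
  have e1' := segment_symm ℝ S.A S.B ▸ e1
  have e2' := segment_symm ℝ S.B S.C ▸ e2
  have e3' := segment_symm ℝ S.C S.A ▸ e3
  have same : ∀ U V Y, segment ℝ U V ⊆ S.outline → D.f Y = 0 → Y ∈ segment ℝ U V →
      (P ∈ segment ℝ U V ∨ Q ∈ segment ℝ U V) → Y ∈ H := by
    intro U V Y h1 hY hYe h
    rcases h with h | h
    · exact prop P Y ((segSub h hYe).trans h1) hY hP.2
    · exact prop Q Y ((segSub h hYe).trans h1) hY hQ.2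
  have sPQ : ∀ U V, segment ℝ U V ⊆ S.outline → P ∈ segment ℝ U V → Q ∈ segment ℝ U V → False :=
    fun U V h hp hq => noPQ ((segSub hp hq).trans h)
  intro Y hYo hY
  have pP := hP.1
  have pQ := hQ.1
  rcases pP with (p | p) | p <;> rcases pQ with (q | q) | q <;> rcases hYo with (y | y) | y <;>
    first
    | exact (sPQ _ _ e1 p q).elim
    | exact (sPQ _ _ e2 p q).elim
    | exact (sPQ _ _ e3 p q).elim
    | exact same _ _ Y e1 hY y (Or.inl p)
    | exact same _ _ Y e2 hY y (Or.inl p)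
    | exact same _ _ Y e3 hY y (Or.inl p)
    | exact same _ _ Y e1 hY y (Or.inr q)
    | exact same _ _ Y e2 hY y (Or.inr q)
    | exact same _ _ Y e3 hY y (Or.inr q)
    | exact gen _ _ _ Y e1 e2 e3 p q y hY
    | exact gen _ _ _ Y e2 e3 e1 p q y hY
    | exact gen _ _ _ Y e3 e1 e2 p q y hY
    | (rw [segment_symm] at p q y
       first
       | exact gen _ _ _ Y e1' e3' e2' p q y hY
       | exact gen _ _ _ Y e3' e2' e1' p q y hY
       | exact gen _ _ _ Y e2' e1' e3' p q y hY)

theorem noMeet (S : Tri) {H O : Set Pt} (D : TD H O) (hd : Disjoint S.outline O)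
    (hI : ∃ P Q : Pt, P ≠ Q ∧ S.outline ∩ H = {P, Q}) : ∀ x ∈ S.hull, x ∉ O := by
  classical
  obtain ⟨P, Q, hPQ, hI⟩ := hI
  have key := edgesIn S D hd hPQ hI
  have e : ∀ Y ∈ S.outline, D.f Y = 0 → Y ∈ H ∧ Y ∉ O :=
    fun Y hY h => ⟨key Y hY h, Set.disjoint_left.1 hd hY⟩
  have e1 : segment ℝ S.A S.B ⊆ S.outline := fun x hx => Or.inl (Or.inl hx)
  have e2 : segment ℝ S.B S.C ⊆ S.outline := fun x hx => Or.inl (Or.inr hx)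
  have e3 : segment ℝ S.C S.A ⊆ S.outline := fun x hx => Or.inr hx
  have e1' := segment_symm ℝ S.A S.B ▸ e1
  have e2' := segment_symm ℝ S.B S.C ▸ e2
  have e3' := segment_symm ℝ S.C S.A ▸ e3
  have a1 : S.A ∈ S.outline := e1 (left_mem_segment _ _ _)
  have a2 : S.B ∈ S.outline := e2 (left_mem_segment _ _ _)
  have a3 : S.C ∈ S.outline := e3 (left_mem_segment _ _ _)
  have := D.hullIn {S.A, S.B, S.C} (by
    intro p hp q hq Y hY
    refine e Y ?_
    simp only [Finset.mem_insert, Finset.mem_singleton] at hp hq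
    rcases hp with rfl | rfl | rfl <;> rcases hq with rfl | rfl | rfl <;>
      first
      | exact e1 hY
      | exact e2 hY
      | exact e3 hY
      | exact e1' hY
      | exact e2' hY
      | exact e3' hY
      | (rw [segment_same, Set.mem_singleton_iff] at hY; subst hY; assumption))
  intro x hx hxO
  refine (this x ?_ ((D.hO x).1 hxO).1).2 hxO
  simpa [Tri.hull] using hx

theorem side {H O : Set Pt} (D : TD H O) {A C C' Y : Pt}
    (hAC : ∀ x ∈ segment ℝ A C, x ∉ H)
    (hO : ∀ x ∈ convexHull ℝ ({A, C, C'} : Set Pt), x ∉ O)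
    (hY : Y ∈ convexHull ℝ ({A, C, C'} : Set Pt)) (hYH : Y ∈ H) :
    0 < D.f A * D.f C ∧ ∃ Z ∈ segment ℝ C C', Z ∈ H := by
  have cv := convex_convexHull ℝ ({A, C, C'} : Set Pt)
  have iA : A ∈ convexHull ℝ ({A, C, C'} : Set Pt) := subset_convexHull _ _ (by simp)
  have iC : C ∈ convexHull ℝ ({A, C, C'} : Set Pt) := subset_convexHull _ _ (by simp)
  have iC' : C' ∈ convexHull ℝ ({A, C, C'} : Set Pt) := subset_convexHull _ _ (by simp)
  have all : ∀ Z ∈ convexHull ℝ ({A, C, C'} : Set Pt), D.f Z = 0 → Z ∈ H :=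
    fun Z hZ h => D.seg hYH h fun p hp => hO p (cv.segment_subset hY hZ hp)
  have hpos : 0 < D.f A * D.f C := by
    by_contra! hc
    obtain ⟨z, hz, hz0⟩ := exZero D.f hc
    exact hAC z hz (all z (cv.segment_subset iA iC hz) hz0)
  refine ⟨hpos, ?_⟩
  have hle : D.f C * D.f C' ≤ 0 := by
    by_contra! hc
    have := posConv (D.f C • D.f) {A, C, C'} (by
      have : D.f C ≠ 0 := by rintro h; simp [h] at hpos
      rintro p (rfl | rfl | rfl)
      · simpa [mul_comm] using hpos
      · simpa using (mul_self_pos.2 this)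
      · simpa using hc) Y hY
    simp [((D.hH Y).1 hYH).1] at this
  obtain ⟨z, hz, hz0⟩ := exZero D.f hle
  exact ⟨z, hz, all z (cv.segment_subset iC iC' hz) hz0⟩

theorem noSide {H O : Set Pt} (D : TD H O) {A B C C' X : Pt}
    (hAC : ∀ x ∈ segment ℝ A C, x ∉ H) (hBC : ∀ x ∈ segment ℝ B C, x ∉ H)
    (hOA : ∀ x ∈ convexHull ℝ ({A, C, C'} : Set Pt), x ∉ O)
    (hOB : ∀ x ∈ convexHull ℝ ({B, C, C'} : Set Pt), x ∉ O)
    (hX : X ∈ convexHull ℝ ({A, B, C} : Set Pt)) (hXH : X ∈ H) :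
    ∀ Y ∈ convexHull ℝ ({A, C, C'} : Set Pt), Y ∉ H := by
  intro Y hY hYH
  obtain ⟨h1, Z, hZ, hZH⟩ := side D hAC hOA hY hYH
  have hZ' : Z ∈ convexHull ℝ ({B, C, C'} : Set Pt) :=
    (convex_convexHull ℝ _).segment_subset (subset_convexHull _ _ (by simp))
      (subset_convexHull _ _ (by simp)) hZ
  obtain ⟨h2, -⟩ := side D hBC hOB hZ' hZH
  have := posConv (D.f C • D.f) {A, B, C} (by
    have : D.f C ≠ 0 := by rintro h; simp [h] at h1
    rintro p (rfl | rfl | rfl)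
    · simpa [mul_comm] using h1
    · simpa [mul_comm] using h2
    · simpa using (mul_self_pos.2 this)) X hX
  simp [((D.hH X).1 hXH).1] at this

theorem exDir (a b : Fin 4 → ℝ) : ∃ w : Fin 4 → ℝ, w ≠ 0 ∧ 0 ≤ w 3 ∧
    w 0 + w 1 + w 2 + w 3 = 0 ∧ w 0 * a 0 + w 1 * a 1 + w 2 * a 2 + w 3 * a 3 = 0 ∧
    w 0 * b 0 + w 1 * b 1 + w 2 * b 2 + w 3 * b 3 = 0 := by
  let M : Matrix (Fin 3) (Fin 4) ℝ := ![![1, 1, 1, 1], a, b]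
  have := LinearMap.ker_ne_bot_of_finrank_lt (f := Matrix.toLin' M) (by simp)
  obtain ⟨w, hw, hw0⟩ := (Submodule.ne_bot_iff _).1 this
  rw [LinearMap.mem_ker, Matrix.toLin'_apply] at hw
  have h0 := congrFun hw 0
  have h1 := congrFun hw 1
  have h2 := congrFun hw 2
  simp [M, Matrix.mulVec, dotProduct, Fin.sum_univ_four] at h0 h1 h2
  rcases le_total 0 (w 3) with h | h
  · exact ⟨w, hw0, h, h0, by linarith, by linarith⟩
  · refine ⟨-w, by simpa using hw0, by simpa using h, ?_, ?_, ?_⟩ <;> simp <;> linarith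

theorem mainAux {A B C C' : Pt} {H1 O1 H2 O2 : Set Pt} (D1 : TD H1 O1) (D2 : TD H2 O2)
    (e1 : ∀ Y ∈ segment ℝ A B ∪ segment ℝ B C ∪ segment ℝ C A, D1.f Y = 0 → Y ∈ H1 ∧ Y ∉ O1)
    (n2 : ∀ Y ∈ segment ℝ A B ∪ segment ℝ B C ∪ segment ℝ C A, Y ∉ H2)
    (n12 : ∀ Y ∈ H1, Y ∉ O2)
    (mA1 : ∀ x ∈ convexHull ℝ ({A, C, C'} : Set Pt), x ∉ O1)
    (mB1 : ∀ x ∈ convexHull ℝ ({B, C, C'} : Set Pt), x ∉ O1)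
    (mA2 : ∀ x ∈ convexHull ℝ ({A, C, C'} : Set Pt), x ∉ O2)
    (mB2 : ∀ x ∈ convexHull ℝ ({B, C, C'} : Set Pt), x ∉ O2)
    {X : Pt} (hX : X ∈ convexHull ℝ ({A, B, C} : Set Pt)) (hX1 : X ∈ H1) (hX2 : X ∈ H2) :
    ∃ Z ∈ convexHull ℝ ({A, B, C'} : Set Pt), Z ∈ H1 ∧ Z ∈ H2 := by
  classical
  have f1X := ((D1.hH X).1 hX1).1
  have f2X := ((D2.hH X).1 hX2).1
  -- side faces avoid the second triangle
  have sA : ∀ Y ∈ convexHull ℝ ({A, C, C'} : Set Pt), Y ∉ H2 :=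
    noSide D2 (fun x hx => n2 x (Or.inr (segment_symm ℝ A C ▸ hx)))
      (fun x hx => n2 x (Or.inl (Or.inr hx))) mA2 mB2 hX hX2
  have sB : ∀ Y ∈ convexHull ℝ ({B, C, C'} : Set Pt), Y ∉ H2 :=
    noSide D2 (fun x hx => n2 x (Or.inl (Or.inr hx)))
      (fun x hx => n2 x (Or.inr (segment_symm ℝ A C ▸ hx))) mB2 mA2
      (by rw [Set.insert_comm]; exact hX) hX2
  -- connecting inside a side face
  have conn : ∀ U V W : Pt, (∀ x ∈ convexHull ℝ ({U, V, W} : Set Pt), x ∉ O1) →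
      (∀ Y ∈ segment ℝ U V, D1.f Y = 0 → Y ∈ H1 ∧ Y ∉ O1) → D1.f U * D1.f V ≤ 0 →
      ∀ Y ∈ convexHull ℝ ({U, V, W} : Set Pt), D1.f Y = 0 → Y ∈ H1 ∧ Y ∉ O1 := by
    intro U V W hm hs hle Y hY hfY
    obtain ⟨z, hz, hz0⟩ := exZero D1.f hle
    have cv := convex_convexHull ℝ ({U, V, W} : Set Pt)
    have hz' := cv.segment_subset (subset_convexHull ℝ _ (by simp : U ∈ ({U, V, W} : Set Pt)))
      (subset_convexHull ℝ _ (by simp : V ∈ ({U, V, W} : Set Pt))) hz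
    exact ⟨D1.seg (hs z hz hz0).1 hfY fun p hp => hm p (cv.segment_subset hz' hY hp), hm Y hY⟩
  have inA : ∀ U V, U ∈ ({A, C, C'} : Set Pt) → V ∈ ({A, C, C'} : Set Pt) →
      ∀ Y ∈ segment ℝ U V, Y ∈ convexHull ℝ ({A, C, C'} : Set Pt) := fun U V hU hV Y hY =>
    (convex_convexHull ℝ _).segment_subset (subset_convexHull ℝ _ hU) (subset_convexHull ℝ _ hV) hY
  have inB : ∀ U V, U ∈ ({B, C, C'} : Set Pt) → V ∈ ({B, C, C'} : Set Pt) →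
      ∀ Y ∈ segment ℝ U V, Y ∈ convexHull ℝ ({B, C, C'} : Set Pt) := fun U V hU hV Y hY =>
    (convex_convexHull ℝ _).segment_subset (subset_convexHull ℝ _ hU) (subset_convexHull ℝ _ hV) hY
  have sAB : ∀ Y ∈ segment ℝ A B, D1.f Y = 0 → Y ∈ H1 ∧ Y ∉ O1 :=
    fun Y hY => e1 Y (Or.inl (Or.inl hY))
  have sBC : ∀ Y ∈ segment ℝ B C, D1.f Y = 0 → Y ∈ H1 ∧ Y ∉ O1 :=
    fun Y hY => e1 Y (Or.inl (Or.inr hY))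
  have sCA : ∀ Y ∈ segment ℝ C A, D1.f Y = 0 → Y ∈ H1 ∧ Y ∉ O1 :=
    fun Y hY => e1 Y (Or.inr hY)
  have sAC : ∀ Y ∈ segment ℝ A C, D1.f Y = 0 → Y ∈ H1 ∧ Y ∉ O1 := segment_symm ℝ A C ▸ sCA
  have hABC : D1.f A * D1.f C ≤ 0 ∨ D1.f B * D1.f C ≤ 0 := by
    by_contra! hc
    have := posConv (D1.f C • D1.f) {A, B, C} (by
      have : D1.f C ≠ 0 := by rintro h; simp [h] at hc
      rintro p (rfl | rfl | rfl)
      · simpa [mul_comm] using hc.1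
      · simpa [mul_comm] using hc.2
      · simpa using (mul_self_pos.2 this)) X hX
    simp [f1X] at this
  have sCC' : ∀ Y ∈ segment ℝ C C', D1.f Y = 0 → Y ∈ H1 ∧ Y ∉ O1 := by
    intro Y hY
    rcases hABC with h | h
    · exact conn A C C' mA1 sAC h Y (inA C C' (by simp) (by simp) Y hY)
    · exact conn B C C' mB1 sBC h Y (inB C C' (by simp) (by simp) Y hY)
  have two : ∀ U, D1.f U * D1.f C' ≤ 0 → 0 < D1.f U * D1.f C → D1.f C * D1.f C' ≤ 0 := by
    intro U h1 h2
    by_contra! h3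
    have h4 := mul_pos h2 h3
    nlinarith [mul_nonneg (neg_nonneg.2 h1) (sq_nonneg (D1.f C))]
  have sAC' : ∀ Y ∈ segment ℝ A C', D1.f Y = 0 → Y ∈ H1 ∧ Y ∉ O1 := by
    intro Y hY hfY
    have hYA := inA A C' (by simp) (by simp) Y hY
    rcases le_or_gt (D1.f A * D1.f C) 0 with h | h
    · exact conn A C C' mA1 sAC h Y hYA hfY
    · have e : ({A, C, C'} : Set Pt) = {C, C', A} := by ext; simp; tauto
      rw [e] at hYA
      exact conn C C' A (e ▸ mA1) sCC' (two A (segSign _ hY hfY) h) Y hYA hfY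
  have sBC' : ∀ Y ∈ segment ℝ B C', D1.f Y = 0 → Y ∈ H1 ∧ Y ∉ O1 := by
    intro Y hY hfY
    have hYA := inB B C' (by simp) (by simp) Y hY
    rcases le_or_gt (D1.f B * D1.f C) 0 with h | h
    · exact conn B C C' mB1 sBC h Y hYA hfY
    · have e : ({B, C, C'} : Set Pt) = {C, C', B} := by ext; simp; tauto
      rw [e] at hYA
      exact conn C C' B (e ▸ mB1) sCC' (two B (segSign _ hY hfY) h) Y hYA hfY
  have tet := D1.hullIn {A, B, C, C'} (by
    intro p hp q hq Y hY
    simp only [Finset.mem_insert, Finset.mem_singleton] at hp hq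
    have hY' := hY
    rw [segment_symm] at hY'
    rcases hp with rfl | rfl | rfl | rfl <;> rcases hq with rfl | rfl | rfl | rfl <;>
      first
      | exact sAB Y hY
      | exact sBC Y hY
      | exact sCA Y hY
      | exact sCC' Y hY
      | exact sAC' Y hY
      | exact sBC' Y hY
      | exact sAB Y hY'
      | exact sBC Y hY'
      | exact sCA Y hY'
      | exact sCC' Y hY'
      | exact sAC' Y hY'
      | exact sBC' Y hY'
      | (rw [segment_same, Set.mem_singleton_iff] at hY; subst hY
         first
         | exact sAB _ (left_mem_segment _ _ _)
         | exact sBC _ (left_mem_segment _ _ _)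
         | exact sCA _ (left_mem_segment _ _ _)
         | exact sCC' _ (right_mem_segment _ _ _)))
  have tet' : ∀ Y ∈ convexHull ℝ ({A, B, C, C'} : Set Pt), D1.f Y = 0 → Y ∈ H1 ∧ Y ∉ O1 := by
    simpa using tet
  -- travel along the common line
  obtain ⟨a, b, c, ha, hb, hc, habc, hXe⟩ := mem_hull3_s19 hX
  obtain ⟨w, hw0, hw3, hw, hwa, hwb⟩ := exDir ![D1.f A, D1.f B, D1.f C, D1.f C']
    ![D2.f A, D2.f B, D2.f C, D2.f C']
  simp at hwa hwb
  have hneg : ∃ i : Fin 3, w i.castSucc < 0 := by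
    by_contra! hcon
    have q0 : 0 ≤ w 0 := hcon 0
    have q1 : 0 ≤ w 1 := hcon 1
    have q2 : 0 ≤ w 2 := hcon 2
    apply hw0
    funext i
    fin_cases i <;> simp <;> linarith
  let y : Fin 3 → ℝ := ![a, b, c]
  have hy : ∀ i, 0 ≤ y i := by intro i; fin_cases i <;> simpa [y]
  obtain ⟨i, hi⟩ := hneg
  obtain ⟨k, hk0, hk⟩ : ∃ k : ℝ, 0 ≤ k ∧ y i + k * w i.castSucc < 0 := by
    refine ⟨(y i + 1) / (- w i.castSucc), div_nonneg (by linarith [hy i]) (by linarith), ?_⟩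
    have : (y i + 1) / (- w i.castSucc) * w i.castSucc = - (y i + 1) := by
      have := hi.ne
      field_simp
    linarith
  obtain ⟨t, ht0, ht1, hall, j, hj⟩ := exit3 y (fun i => y i + k * w i.castSucc) hy ⟨i, hk⟩
  set s := t * k with hs
  have hs0 : 0 ≤ s := mul_nonneg ht0 hk0
  have co : ∀ i, (1 - t) * y i + t * (y i + k * w i.castSucc) = y i + s * w i.castSucc := by
    intro i; rw [hs]; ring
  simp only [co] at hall hj
  have g0 : 0 ≤ a + s * w 0 := hall 0
  have g1 : 0 ≤ b + s * w 1 := hall 1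
  have g2 : 0 ≤ c + s * w 2 := hall 2
  have g3 : 0 ≤ s * w 3 := mul_nonneg hs0 hw3
  have gs : (a + s * w 0) + (b + s * w 1) + (c + s * w 2) + s * w 3 = 1 := by
    linear_combination habc + s * hw
  set Z : Pt := (a + s * w 0) • A + (b + s * w 1) • B + (c + s * w 2) • C + (s * w 3) • C' with hZ
  have cv := convex_convexHull ℝ ({A, B, C, C'} : Set Pt)
  have hZT : Z ∈ convexHull ℝ ({A, B, C, C'} : Set Pt) :=
    comb4 cv (subset_convexHull _ _ (by simp)) (subset_convexHull _ _ (by simp))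
      (subset_convexHull _ _ (by simp)) (subset_convexHull _ _ (by simp)) g0 g1 g2 g3 gs
  have hXT : X ∈ convexHull ℝ ({A, B, C, C'} : Set Pt) :=
    convexHull_mono (by intro x; simp; tauto) hX
  have f1Z : D1.f Z = 0 := by
    rw [hXe, aff3 _ _ _ _ _ _ _ habc] at f1X
    rw [hZ, aff4 _ _ _ _ _ _ _ _ _ gs]
    linear_combination f1X + s * hwa
  have f2Z : D2.f Z = 0 := by
    rw [hXe, aff3 _ _ _ _ _ _ _ habc] at f2X
    rw [hZ, aff4 _ _ _ _ _ _ _ _ _ gs]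
    linear_combination f2X + s * hwb
  have hZ1 := (tet' Z hZT f1Z).1
  have hZ2 : Z ∈ H2 := by
    refine D2.seg hX2 f2Z fun p hp => n12 p (tet' p (cv.segment_subset hXT hZT hp) ?_).1
    obtain ⟨u, v, -, -, huv, rfl⟩ := hp
    rw [aff2 _ _ _ _ _ huv, f1X, f1Z]; simp
  refine ⟨Z, ?_, hZ1, hZ2⟩
  fin_cases j
  · exfalso
    replace hj : a + s * w 0 = 0 := hj
    refine sB Z ?_ hZ2
    rw [hZ, hj, zero_smul, zero_add]
    exact comb3 (convex_convexHull _ _) (subset_convexHull _ _ (by simp))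
      (subset_convexHull _ _ (by simp)) (subset_convexHull _ _ (by simp)) g1 g2 g3 (by linarith)
  · exfalso
    replace hj : b + s * w 1 = 0 := hj
    refine sA Z ?_ hZ2
    rw [hZ, hj, zero_smul, add_zero]
    exact comb3 (convex_convexHull _ _) (subset_convexHull _ _ (by simp))
      (subset_convexHull _ _ (by simp)) (subset_convexHull _ _ (by simp)) g0 g2 g3 (by linarith)
  · replace hj : c + s * w 2 = 0 := hj
    rw [hZ, hj, zero_smul, add_zero]
    exact comb3 (convex_convexHull _ _) (subset_convexHull _ _ (by simp))
      (subset_convexHull _ _ (by simp)) (subset_convexHull _ _ (by simp)) g0 g1 g3 (by linarith)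

/-- After an elementary move of `Δ0 = ABC` to `Δ0' = ABC'` in a Borromean configuration,
`⟨Δ0'⟩ ∩ ⟨Δ1⟩ ∩ ⟨Δ2⟩ ≠ ∅`. -/
theorem stmt19 (Δ0 Δ1 Δ2 : Tri)
    (h01 : Disjoint Δ0.outline Δ1.outline)
    (h12 : Disjoint Δ1.outline Δ2.outline)
    (h20 : Disjoint Δ2.outline Δ0.outline)
    (hcap : (Δ0.hull ∩ Δ1.hull ∩ Δ2.hull).Nonempty)
    (t0 : ∃ P Q : Pt, P ≠ Q ∧ Δ0.outline ∩ Δ1.hull = {P, Q})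
    (t1 : ∃ P Q : Pt, P ≠ Q ∧ Δ1.outline ∩ Δ2.hull = {P, Q})
    (t2 : ∃ P Q : Pt, P ≠ Q ∧ Δ2.outline ∩ Δ0.hull = {P, Q})
    (C' : Pt) (hC' : C' ∉ affineSpan ℝ ({Δ0.A, Δ0.B} : Set Pt))
    (hmove : (convexHull ℝ ({Δ0.A, Δ0.C, C'} : Set Pt) ∪
        convexHull ℝ ({Δ0.B, Δ0.C, C'} : Set Pt)) ∩ (Δ1.outline ∪ Δ2.outline) = ∅)
    (Δ0' : Tri) (hA : Δ0'.A = Δ0.A) (hB : Δ0'.B = Δ0.B) (hC : Δ0'.C = C') :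
    (Δ0'.hull ∩ Δ1.hull ∩ Δ2.hull).Nonempty := by
  obtain ⟨D0⟩ := exTD Δ0
  obtain ⟨D1⟩ := exTD Δ1
  obtain ⟨D2⟩ := exTD Δ2
  obtain ⟨X, ⟨hX0, hX1⟩, hX2⟩ := hcap
  have n12 := noMeet Δ1 D2 h12 t1
  have n20 := noMeet Δ2 D0 h20 t2
  obtain ⟨P, Q, hPQ, hI⟩ := t0
  have e1 := edgesIn Δ0 D1 h01 hPQ hI
  have mv : ∀ x, x ∈ convexHull ℝ ({Δ0.A, Δ0.C, C'} : Set Pt) ∨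
      x ∈ convexHull ℝ ({Δ0.B, Δ0.C, C'} : Set Pt) → x ∉ Δ1.outline ∧ x ∉ Δ2.outline := by
    intro x hx
    constructor <;> intro h
    · exact (Set.eq_empty_iff_forall_notMem.1 hmove x) ⟨hx, Or.inl h⟩
    · exact (Set.eq_empty_iff_forall_notMem.1 hmove x) ⟨hx, Or.inr h⟩
  obtain ⟨Z, hZ, hZ1, hZ2⟩ := mainAux (A := Δ0.A) (B := Δ0.B) (C := Δ0.C) (C' := C') D1 D2
    (fun Y hY h => ⟨e1 Y hY h, Set.disjoint_left.1 h01 hY⟩)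
    (fun Y hY h => n20 Y h hY) n12
    (fun x hx => (mv x (Or.inl hx)).1) (fun x hx => (mv x (Or.inr hx)).1)
    (fun x hx => (mv x (Or.inl hx)).2) (fun x hx => (mv x (Or.inr hx)).2) hX0 hX1 hX2
  refine ⟨Z, ⟨?_, hZ1⟩, hZ2⟩
  rw [Tri.hull, hA, hB, hC]
  exact hZ
end
end
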